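/- (Partie finie of the twice-iterated Poisson integral at a singular point.) Let F ∈ 𝓕 with integer exponents and F = O(|x|^{−5−η}) at infinity for some η > 0. For x' ∉ {y₁, y₂} set Q(x') := −(1/4π) Pf_{s₁,s₂} ∫ |x − x'| F(x) d³x, and set Q(y₁) := −(1/4π) Pf_{s₁,s₂} ∫ r₁ F(x) d³x, assuming these partie-finie integrals exist. Then there exist finitely many real numbers c_a, d_a, indexed by negative integers a, such that as r' → 0⁺: (1/4π) ∫_{S²} Q(y₁ + r' n') dΩ(n') = Σ_{a<0} (c_a + d_a ln r') r'^a + (r₁⁴F)₁ ln(r'/s₁) + [ Q(y₁) + (1/2)(r₁⁴F)₁ ] + o(1), where (r₁⁴F)₁ = (1/4π) ∫_{S²} f_{−4} dΩ. In particular the Hadamard partie finie of Q at y₁ equals Q(y₁) + [ln(r'/s₁) + 1/2] (r₁⁴F)₁. -/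

import Mathlib

open MeasureTheory Filter Topology Real Asymptotics

noncomputable section

abbrev E3 : Type := EuclideanSpace ℝ (Fin 3)
abbrev S2 : Type := Metric.sphere (0 : E3) 1

/-- The surface measure `dΩ` on the unit sphere `S²` (total mass `4π`). -/
def dOmega : Measure S2 := (volume : Measure E3).toSphere

/-- A function on the unit sphere is smooth iff it is the restriction of
a smooth function on `ℝ³`. -/
def SmoothSphereFn (f : S2 → ℝ) : Prop :=
  ∃ g : E3 → ℝ, ContDiff ℝ (⊤ : ℕ∞) g ∧ ∀ n : S2, g (n : E3) = f n

/-- `F` admits a power-like singular expansion at `y` with coefficients `c`: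
the family of exponents (the `a`'s with `c a ≠ 0`) is bounded below, with only
finitely many exponents below any given bound, the coefficients are smooth
functions on the sphere, and for every `N`, `F(y + r n) = Σ_{a ≤ N} r^a (c a)(n)
+ o(r^N)` as `r → 0⁺`, uniformly in `n ∈ S²`. -/
structure HasSingExpansion (y : E3) (F : E3 → ℝ) (c : ℝ → S2 → ℝ) : Prop where
  smooth_coeffs : ∀ a : ℝ, SmoothSphereFn (c a)
  bddBelow : ∃ a₀ : ℝ, ∀ a : ℝ, a < a₀ → c a = 0
  finite_exponents : ∀ N : ℝ, {a : ℝ | a ≤ N ∧ c a ≠ 0}.Finite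
  expansion : ∀ N : ℕ, ∀ ε > 0, ∃ δ > 0, ∀ r : ℝ, 0 < r → r < δ → ∀ n : S2,
    |F (y + r • (n : E3)) - ∑ᶠ (a : ℝ) (_ : a ≤ (N : ℝ)), r ^ a * c a n| ≤ ε * r ^ (N : ℝ)

/-- The exponents of the singular expansion are integers. -/
def IntegerExponents (c : ℝ → S2 → ℝ) : Prop :=
  ∀ a : ℝ, c a ≠ 0 → ∃ k : ℤ, a = (k : ℝ)

/-- The Hadamard partie finie at the singular point, `(F)_y = (1/4π) ∫_{S²} f₀ dΩ`,
expressed in terms of the expansion coefficients `c` of `F`. -/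
def pfAt (c : ℝ → S2 → ℝ) : ℝ :=
  (4 * π)⁻¹ * ∫ n : S2, c 0 n ∂dOmega

/-- `F` is smooth on a punctured neighbourhood of `y`. -/
def SmoothNearPunctured (y : E3) (F : E3 → ℝ) : Prop :=
  ∃ U ∈ 𝓝 y, ContDiffOn ℝ (⊤ : ℕ∞) F (U \ {y})

/-- The quantity whose limit as `s → 0⁺` defines the Hadamard partie finie
`Pf_{s₁,s₂} ∫ F d³x`: the integral over `ℝ³` minus two balls of radius `s`,
plus the divergent subtractions built from the expansion coefficients `c` at `y₁`
and `d` at `y₂`. -/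
def pfApprox (y₁ y₂ : E3) (s₁ s₂ : ℝ) (F : E3 → ℝ) (c d : ℝ → S2 → ℝ) (s : ℝ) : ℝ :=
  (∫ x in (Metric.closedBall y₁ s ∪ Metric.closedBall y₂ s)ᶜ, F x)
    + (∑ᶠ (a : ℝ) (_ : a < -3), s ^ (a + 3) / (a + 3) * ∫ n : S2, c a n ∂dOmega)
    + Real.log (s / s₁) * (∫ n : S2, c (-3) n ∂dOmega)
    + (∑ᶠ (b : ℝ) (_ : b < -3), s ^ (b + 3) / (b + 3) * ∫ n : S2, d b n ∂dOmega)
    + Real.log (s / s₂) * (∫ n : S2, d (-3) n ∂dOmega)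

/-- `Pf_{s₁,s₂} ∫ F d³x` exists and equals `L`. -/
def HasPfIntegral (y₁ y₂ : E3) (s₁ s₂ : ℝ) (F : E3 → ℝ) (c d : ℝ → S2 → ℝ) (L : ℝ) : Prop :=
  Tendsto (pfApprox y₁ y₂ s₁ s₂ F c d) (𝓝[>] (0 : ℝ)) (𝓝 L)

/-- Membership in the class `𝓕`: smooth outside `{y₁, y₂}` and admitting singular
expansions at `y₁` (coefficients `c`) and `y₂` (coefficients `d`). -/
structure MemF (y₁ y₂ : E3) (F : E3 → ℝ) (c d : ℝ → S2 → ℝ) : Prop where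
  smooth : ContDiffOn ℝ (⊤ : ℕ∞) F ({y₁, y₂}ᶜ : Set E3)
  exp₁ : HasSingExpansion y₁ F c
  exp₂ : HasSingExpansion y₂ F d

/-- The partial derivative `∂_i F` (as a plain function, defined outside the
singularities via `fderiv`). -/
def pder (i : Fin 3) (F : E3 → ℝ) (x : E3) : ℝ :=
  fderiv ℝ F x (EuclideanSpace.single i 1)


instance dOmega_finite : IsFiniteMeasure dOmega := by unfold dOmega; infer_instance

lemma dOmega_real_univ : dOmega.real Set.univ = 4 * π := by
  unfold dOmega
  rw [Measure.toSphere_real_apply_univ, Measure.real, EuclideanSpace.volume_ball_fin_three]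
  simp
  rw [ENNReal.toReal_ofReal (by positivity)]
  ring

lemma sphere_integrable {f : S2 → ℝ} (hf : Continuous f) : Integrable f dOmega :=
  hf.integrable_of_hasCompactSupport (HasCompactSupport.of_compactSpace f)

lemma polar_integral (g : E3 → ℝ) (hg : Integrable g) :
    ∫ x, g x = ∫ r in Set.Ioi (0:ℝ), r ^ 2 * ∫ n : S2, g (r • (n : E3)) ∂dOmega := by
  have h3 : Module.finrank ℝ E3 - 1 = 2 := by simp
  have mp := (volume : Measure E3).measurePreserving_homeomorphUnitSphereProd
  rw [h3] at mp
  have e1 : ∫ x, g x = ∫ x : ({(0)}ᶜ : Set E3), g x.1 ∂((volume : Measure E3).comap (↑)) := by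
    rw [integral_subtype_comap (measurableSet_singleton _).compl fun x ↦ g x,
        restrict_compl_singleton]
  have key : ∀ x : ({(0)}ᶜ : Set E3), g x.1 =
      (fun z : S2 × Set.Ioi (0:ℝ) => g (z.2.1 • z.1.1)) (homeomorphUnitSphereProd E3 x) := by
    intro x
    have hx : ‖x.1‖ ≠ 0 := norm_ne_zero_iff.2 x.2
    simp [smul_smul, hx]
  have e2 : ∫ x, g x = ∫ z, g (z.2.1 • z.1.1) ∂((volume : Measure E3).toSphere.prod (.volumeIoiPow 2)) := by
    rw [e1]
    simp_rw [key]
    exact mp.integral_comp (Homeomorph.measurableEmbedding _) (fun z : S2 × Set.Ioi (0:ℝ) => g (z.2.1 • z.1.1))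
  have int1 : Integrable (fun z : S2 × Set.Ioi (0:ℝ) => g (z.2.1 • z.1.1)) ((volume : Measure E3).toSphere.prod (.volumeIoiPow 2)) := by
    rw [← mp.integrable_comp_emb (Homeomorph.measurableEmbedding _)]
    have : ((fun z : S2 × Set.Ioi (0:ℝ) => g (z.2.1 • z.1.1)) ∘ (homeomorphUnitSphereProd E3)) = fun x => g x.1 := by
      funext x; exact (key x).symm
    rw [this]
    have := (integrableOn_iff_comap_subtypeVal (f := g) (μ := volume) (s := ({(0)}ᶜ : Set E3)) (measurableSet_singleton _).compl).1 hg.integrableOn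
    exact this
  rw [e2, integral_prod_symm _ int1]
  simp only [Measure.volumeIoiPow, ENNReal.ofReal]
  rw [integral_withDensity_eq_integral_smul,
    integral_subtype_comap measurableSet_Ioi fun a ↦ Real.toNNReal (a ^ 2) • ∫ n : S2, g (a • (n : E3)) ∂((volume : Measure E3).toSphere),
    setIntegral_congr_fun measurableSet_Ioi fun x hx ↦ ?_]
  · rw [NNReal.smul_def, Real.coe_toNNReal _ (pow_nonneg hx.out.le _)]
    rfl
  · exact (measurable_subtype_coe.pow_const _).real_toNNReal

lemma polar_annulus (y : E3) (g : E3 → ℝ) (s ρ : ℝ) (hs : 0 ≤ s) (hsr : s ≤ ρ)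
    (hg : IntegrableOn g (Metric.closedBall y ρ \ Metric.closedBall y s)) :
    ∫ x in Metric.closedBall y ρ \ Metric.closedBall y s, g x =
      ∫ r in s..ρ, r ^ 2 * ∫ n : S2, g (y + r • (n : E3)) ∂dOmega := by
  have hm : MeasurableSet (Metric.closedBall y ρ \ Metric.closedBall y s) :=
    Metric.isClosed_closedBall.measurableSet.diff Metric.isClosed_closedBall.measurableSet
  rw [← integral_indicator hm, intervalIntegral.integral_of_le hsr]
  rw [← integral_add_left_eq_self _ y, polar_integral]
  · have : ∀ r ∈ Set.Ioi (0:ℝ), (r ^ 2 * ∫ n : S2, (Metric.closedBall y ρ \ Metric.closedBall y s).indicator g (y + r • (n : E3)) ∂dOmega)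
       = (Set.Ioc s ρ).indicator (fun r => r ^ 2 * ∫ n : S2, g (y + r • (n : E3)) ∂dOmega) r := by
      intro r hr
      have hr : 0 < r := hr
      have hmem : ∀ n : S2, (y + r • (n : E3)) ∈ (Metric.closedBall y ρ \ Metric.closedBall y s) ↔ r ∈ Set.Ioc s ρ := by
        intro n
        simp [norm_smul, abs_of_pos hr, and_comm]
      by_cases h : r ∈ Set.Ioc s ρ
      · rw [Set.indicator_of_mem h]
        congr 1
        refine integral_congr_ae (Eventually.of_forall fun n => ?_)
        simp only
        rw [Set.indicator_of_mem ((hmem n).2 h)]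
      · rw [Set.indicator_of_notMem h]
        have : ∀ n : S2, (Metric.closedBall y ρ \ Metric.closedBall y s).indicator g (y + r • (n : E3)) = 0 :=
          fun n => Set.indicator_of_notMem (fun h' => h ((hmem n).1 h')) _
        simp [this]
    rw [setIntegral_congr_fun measurableSet_Ioi this, setIntegral_indicator measurableSet_Ioc]
    congr 2
    ext r
    simp only [Set.mem_inter_iff, Set.mem_Ioi, Set.mem_Ioc]
    constructor
    · rintro ⟨_, h⟩; exact h
    · intro h; exact ⟨by linarith [h.1], h⟩
  · have := (integrable_indicator_iff hm).2 hg
    exact this.comp_add_left y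

lemma gk_integrable (k : ℕ) : Integrable (fun t : ℝ => t ^ k * rexp (-t ^ 2)) := by
  have := integrable_rpow_mul_exp_neg_mul_sq (b := 1) one_pos (s := k) (by
    have : (0:ℝ) ≤ k := Nat.cast_nonneg k
    linarith)
  simpa using this

lemma gk_Ioi (k : ℕ) : ∫ t in Set.Ioi (0:ℝ), t ^ k * rexp (-t ^ 2) = 1 / 2 * Gamma ((k + 1) / 2) := by
  have := integral_rpow_mul_exp_neg_rpow (p := 2) (q := k) two_pos (by
    have : (0:ℝ) ≤ k := Nat.cast_nonneg k
    linarith)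
  simpa using this

lemma gk_even (j : ℕ) : ∫ t : ℝ, t ^ (2 * j) * rexp (-t ^ 2) = Gamma (j + 1 / 2) := by
  have := integral_comp_abs (f := fun t : ℝ => t ^ (2 * j) * rexp (-t ^ 2))
  rw [gk_Ioi] at this
  have h2 : ∀ x : ℝ, |x| ^ (2 * j) * rexp (-|x| ^ 2) = x ^ (2 * j) * rexp (-x ^ 2) := by
    intro x
    rw [pow_mul, pow_mul, sq_abs]
  simp only [h2] at this
  rw [this]
  push_cast
  rw [show ((2 * (j:ℝ) + 1) / 2) = j + 1 / 2 by ring]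
  ring

lemma gk_odd (j : ℕ) : ∫ t : ℝ, t ^ (2 * j + 1) * rexp (-t ^ 2) = 0 := by
  have h := integral_neg_eq_self (fun t : ℝ => t ^ (2 * j + 1) * rexp (-t ^ 2)) volume
  have h2 : ∀ t : ℝ, (-t) ^ (2 * j + 1) * rexp (-(-t) ^ 2) = -(t ^ (2 * j + 1) * rexp (-t ^ 2)) := by
    intro t
    rw [Odd.neg_pow ⟨j, rfl⟩, neg_sq]; ring
  simp only [h2, integral_neg] at h
  linarith

lemma gauss3 (e : E3) (he : ‖e‖ = 1) (k : ℕ) :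
    Integrable (fun x : E3 => (inner ℝ x e) ^ k * rexp (-‖x‖ ^ 2)) ∧
    ∫ x : E3, (inner ℝ x e) ^ k * rexp (-‖x‖ ^ 2) =
      (∫ t : ℝ, t ^ k * rexp (-t ^ 2)) * π := by
  have hcard : Module.finrank ℝ E3 = Fintype.card (Fin 3) := by simp
  have hon : Orthonormal ℝ (({0} : Set (Fin 3)).domRestrict (fun _ : Fin 3 => e)) := by
    constructor
    · intro i; simpa using he
    · intro i j hij
      exact absurd (Subsingleton.elim i j) hij
  obtain ⟨b, hb⟩ := hon.exists_orthonormalBasis_extension_of_card_eq hcard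
  have hb0 : b 0 = e := hb 0 rfl
  let f : Fin 3 → ℝ → ℝ := fun i t => (if i = 0 then t ^ k else 1) * rexp (-t ^ 2)
  have hf : ∀ i, Integrable (f i) := by
    intro i
    by_cases h : i = 0
    · simp only [f, h, if_true]; exact gk_integrable k
    · simp only [f, h, if_false]
      simpa using gk_integrable 0
  have mp1 := b.measurePreserving_repr
  have mp2 := EuclideanSpace.volume_preserving_symm_measurableEquiv_toLp (Fin 3)
  have key : (fun x : E3 => (inner ℝ x e) ^ k * rexp (-‖x‖ ^ 2)) =
      ((fun v : Fin 3 → ℝ => ∏ i, f i (v i)) ∘ (MeasurableEquiv.toLp 2 (Fin 3 → ℝ)).symm) ∘ b.repr := by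
    funext x
    have h1 : inner ℝ x e = (b.repr x) 0 := by
      rw [b.repr_apply_apply, hb0, real_inner_comm]
    have h2 : ‖x‖ ^ 2 = (b.repr x) 0 ^ 2 + (b.repr x) 1 ^ 2 + (b.repr x) 2 ^ 2 := by
      rw [← b.repr.norm_map x, EuclideanSpace.norm_sq_eq]
      simp [Fin.sum_univ_three]
    simp only [Function.comp]
    rw [h1, h2]
    simp only [f, Fin.prod_univ_three]
    simp
    rw [exp_add, exp_add]
    ring
  constructor
  · rw [key, mp1.integrable_comp_emb b.repr.toHomeomorph.measurableEmbedding,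
      mp2.integrable_comp_emb (MeasurableEquiv.measurableEmbedding _)]
    exact Integrable.fintype_prod (f := f) (μ := fun _ => volume) hf
  · rw [key]
    rw [show (∫ x, (((fun v : Fin 3 → ℝ => ∏ i, f i (v i)) ∘ (MeasurableEquiv.toLp 2 (Fin 3 → ℝ)).symm) ∘ b.repr) x) = _ from
      mp1.integral_comp b.repr.toHomeomorph.measurableEmbedding ((fun v : Fin 3 → ℝ => ∏ i, f i (v i)) ∘ (MeasurableEquiv.toLp 2 (Fin 3 → ℝ)).symm)]
    rw [show (∫ x, (((fun v : Fin 3 → ℝ => ∏ i, f i (v i)) ∘ (MeasurableEquiv.toLp 2 (Fin 3 → ℝ)).symm)) x) = _ from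
      mp2.integral_comp (MeasurableEquiv.measurableEmbedding _) (fun v : Fin 3 → ℝ => ∏ i, f i (v i))]
    rw [integral_fintype_prod_volume_eq_prod, Fin.prod_univ_three]
    have hg : ∫ t : ℝ, rexp (-t ^ 2) = √π := by simpa using integral_gaussian 1
    simp only [f]
    simp [hg]
    rw [mul_assoc, Real.mul_self_sqrt pi_pos.le]

lemma moment_rel (e : E3) (he : ‖e‖ = 1) (k : ℕ) :
    (1 / 2 * Gamma ((k + 3) / 2)) * ∫ n : S2, (inner ℝ (n : E3) e) ^ k ∂dOmega =
      (∫ t : ℝ, t ^ k * rexp (-t ^ 2)) * π := by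
  obtain ⟨h1, h2⟩ := gauss3 e he k
  rw [← h2, polar_integral _ h1]
  have h3 : ∀ r ∈ Set.Ioi (0:ℝ), (r ^ 2 * ∫ n : S2, (inner ℝ (r • (n : E3)) e) ^ k * rexp (-‖r • (n : E3)‖ ^ 2) ∂dOmega)
      = (r ^ (k + 2) * rexp (-r ^ 2)) * ∫ n : S2, (inner ℝ (n : E3) e) ^ k ∂dOmega := by
    intro r hr
    rw [← integral_const_mul, ← integral_const_mul]
    refine integral_congr_ae (Eventually.of_forall fun n => ?_)
    simp only [inner_smul_left, norm_smul]
    simp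
    ring
  rw [setIntegral_congr_fun measurableSet_Ioi h3, integral_mul_const, gk_Ioi]
  push_cast
  ring_nf

lemma moment (e : E3) (he : ‖e‖ = 1) (k : ℕ) :
    ∫ n : S2, (inner ℝ (n : E3) e) ^ k ∂dOmega = 2 * π * ∫ u in (-1:ℝ)..1, u ^ k := by
  have h := moment_rel e he k
  have hpos : 0 < Gamma (((k:ℝ) + 3) / 2) := Gamma_pos_of_pos (by positivity)
  obtain ⟨j, hj | hj⟩ := Nat.even_or_odd' k
  · subst hj
    rw [gk_even] at h
    rw [integral_pow]
    have hG : Gamma ((((2 * j : ℕ):ℝ) + 3) / 2) = (j + 1 / 2) * Gamma (j + 1 / 2) := by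
      rw [← Gamma_add_one (by positivity)]
      congr 1; push_cast; ring
    rw [hG] at h
    have hp2 : 0 < Gamma ((j:ℝ) + 1 / 2) := Gamma_pos_of_pos (by positivity)
    have h4 : (-1:ℝ) ^ (2 * j + 1) = -1 := Odd.neg_one_pow ⟨j, rfl⟩
    rw [h4]
    have hj0 : (0:ℝ) ≤ j := Nat.cast_nonneg j
    have : (1 / 2 * ((j:ℝ) + 1 / 2)) * ∫ n : S2, (inner ℝ (n : E3) e) ^ (2 * j) ∂dOmega = π := by
      have := mul_left_cancel₀ hp2.ne' (a := Gamma ((j:ℝ) + 1 / 2)) (b := (1 / 2 * ((j:ℝ) + 1 / 2)) * ∫ n : S2, (inner ℝ (n : E3) e) ^ (2 * j) ∂dOmega) (c := π) (by linarith)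
      exact this
    push_cast
    field_simp
    field_simp at this
    rw [one_pow]
    linarith
  · subst hj
    rw [gk_odd] at h
    rw [integral_pow]
    have h4 : (-1:ℝ) ^ (2 * j + 1 + 1) = 1 := Even.neg_one_pow ⟨j + 1, by ring⟩
    rw [h4]
    have : (1 / 2 * Gamma ((((2 * j + 1 : ℕ):ℝ) + 3) / 2)) ≠ 0 := by positivity
    simp only [zero_mul, mul_eq_zero, this, false_or] at h
    rw [h]; simp

lemma archimedes (e : E3) (he : ‖e‖ = 1) (g : ℝ → ℝ) (hg : Continuous g) :
    ∫ n : S2, g (inner ℝ (n : E3) e) ∂dOmega = 2 * π * ∫ u in (-1:ℝ)..1, g u := by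
  have hpoly : ∀ p : Polynomial ℝ, ∫ n : S2, p.eval (inner ℝ (n : E3) e) ∂dOmega = 2 * π * ∫ u in (-1:ℝ)..1, p.eval u := by
    intro p
    simp only [Polynomial.eval_eq_sum_range]
    rw [integral_finsetSum, intervalIntegral.integral_finsetSum, Finset.mul_sum]
    · refine Finset.sum_congr rfl fun i _ => ?_
      rw [integral_const_mul, moment e he, intervalIntegral.integral_const_mul]
      ring
    · intro i _
      exact Continuous.intervalIntegrable (by fun_prop) _ _
    · intro i _
      exact sphere_integrable (by fun_prop)
  have hin : ∀ n : S2, (inner ℝ (n : E3) e) ∈ Set.Icc (-1:ℝ) 1 := by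
    intro n
    have := abs_real_inner_le_norm (n : E3) e
    rw [he, norm_eq_of_mem_sphere n] at this
    exact abs_le.1 (by simpa using this)
  by_contra hne
  have hd : 0 < |∫ n : S2, g (inner ℝ (n : E3) e) ∂dOmega - 2 * π * ∫ u in (-1:ℝ)..1, g u| :=
    abs_pos.2 (sub_ne_zero.2 hne)
  set D := |∫ n : S2, g (inner ℝ (n : E3) e) ∂dOmega - 2 * π * ∫ u in (-1:ℝ)..1, g u| with hD
  have hpi := pi_pos
  obtain ⟨p, hp⟩ := exists_polynomial_near_of_continuousOn (-1) 1 g hg.continuousOn (D / (16 * π)) (by positivity)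
  have a1 : |∫ n : S2, (p.eval (inner ℝ (n : E3) e) - g (inner ℝ (n : E3) e)) ∂dOmega| ≤ D / (16 * π) * (4 * π) := by
    rw [← dOmega_real_univ, ← Real.norm_eq_abs]
    refine norm_integral_le_of_norm_le_const (Eventually.of_forall fun n => ?_)
    exact (hp _ (hin n)).le
  have a2 : |∫ u in (-1:ℝ)..1, (p.eval u - g u)| ≤ D / (16 * π) * |1 - (-1)| := by
    rw [← Real.norm_eq_abs]
    refine intervalIntegral.norm_integral_le_of_norm_le_const fun u hu => ?_
    rw [Set.uIoc_of_le (by norm_num)] at hu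
    exact (hp u ⟨hu.1.le, hu.2⟩).le
  rw [integral_sub (sphere_integrable (by fun_prop)) (sphere_integrable (by fun_prop)), hpoly] at a1
  rw [intervalIntegral.integral_sub (Continuous.intervalIntegrable (by fun_prop) _ _) (Continuous.intervalIntegrable (by fun_prop) _ _)] at a2
  have e1 : D / (16 * π) * (4 * π) = D / 4 := by field_simp; norm_num
  have e2 : |2 * π * ((∫ u in (-1:ℝ)..1, p.eval u) - ∫ u in (-1:ℝ)..1, g u)| ≤ D / 4 := by
    rw [abs_mul, abs_of_pos (by positivity : 0 < 2 * π)]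
    have : D / 4 = 2 * π * (D / (16 * π) * |1 - (-1)|) := by
      norm_num; field_simp; norm_num
    rw [this]
    gcongr
  rw [e1] at a1
  rw [abs_le] at a1 e2
  have : D ≤ D / 2 := by
    rw [hD, abs_le]; rw [← hD]
    constructor <;> linarith [a1.1, a1.2, e2.1, e2.2]
  linarith

/-- spherical mean of the distance -/
def Mavg (r r' : ℝ) : ℝ := if r ≤ r' then r' + r ^ 2 / (3 * r') else r + r' ^ 2 / (3 * r)

lemma avg_dist (w : E3) (r' : ℝ) (hr' : 0 < r') (hw : w ≠ 0) :
    ∫ n : S2, ‖w - r' • (n : E3)‖ ∂dOmega = 4 * π * Mavg ‖w‖ r' := by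
  set r := ‖w‖ with hr
  have hrp : 0 < r := norm_pos_iff.2 hw
  have he : ‖r⁻¹ • w‖ = 1 := by
    rw [norm_smul, ← hr, norm_inv, norm_of_nonneg hrp.le]; field_simp
  have h1 : ∀ n : S2, ‖w - r' • (n : E3)‖ = √(r ^ 2 + r' ^ 2 - 2 * r * r' * inner ℝ (n : E3) (r⁻¹ • w)) := by
    intro n
    rw [← Real.sqrt_sq (norm_nonneg (w - r' • (n : E3)))]
    congr 1
    rw [norm_sub_sq_real, inner_smul_right, inner_smul_right, norm_smul, norm_eq_of_mem_sphere n,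
        Real.norm_of_nonneg hr'.le, ← hr, real_inner_comm]
    field_simp
    ring
  simp_rw [h1]
  rw [archimedes _ he (fun u => √(r ^ 2 + r' ^ 2 - 2 * r * r' * u)) (by fun_prop)]
  have hB : 2 * r * r' ≠ 0 := by positivity
  rw [intervalIntegral.integral_comp_sub_mul (fun t => √t) hB]
  have hsq : ∀ x : ℝ, (x ^ 2) ^ ((1:ℝ) / 2 + 1) = |x| ^ 3 := by
    intro x
    rw [← sq_abs, ← Real.rpow_natCast, ← Real.rpow_natCast, ← Real.rpow_mul (abs_nonneg x)]
    norm_num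
  simp_rw [Real.sqrt_eq_rpow]
  rw [integral_rpow (Or.inl (by norm_num))]
  rw [show r ^ 2 + r' ^ 2 - 2 * r * r' * -1 = (r + r') ^ 2 by ring,
    show r ^ 2 + r' ^ 2 - 2 * r * r' * 1 = (r - r') ^ 2 by ring, hsq, hsq, smul_eq_mul,
    abs_of_pos (by positivity : 0 < r + r')]
  unfold Mavg
  split_ifs with h
  · rw [abs_of_nonpos (by linarith)]
    field_simp
    ring
  · rw [abs_of_pos (by linarith)]
    field_simp
    ring

/-- uniform expansion up to a bounded remainder -/
def UE {X : Type} (T : ℝ → X → ℝ) (β : ℝ → X → ℝ) : Prop :=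
  ∃ I : Finset ℝ, (∀ a ∈ I, a < 0) ∧ (∀ a, a < 0 → a ∉ I → ∀ x, β a x = 0) ∧
    ∃ δ > 0, ∃ C, ∀ r, 0 < r → r < δ → ∀ x, |T r x - ∑ a ∈ I, r ^ a * β a x| ≤ C

def HasExp (h P : ℝ → ℝ) : Prop := UE (X := Unit) (fun r _ => h r) (fun a _ => P a)

lemma sum_enlarge {X : Type} {β : ℝ → X → ℝ} {I J : Finset ℝ} (hIJ : I ⊆ J) (hJ : ∀ a ∈ J, a < 0)
    (hI : ∀ a, a < 0 → a ∉ I → ∀ x, β a x = 0) (f : ℝ → ℝ) (x : X) :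
    ∑ a ∈ I, f a * β a x = ∑ a ∈ J, f a * β a x := by
  refine Finset.sum_subset hIJ fun a ha hna => ?_
  rw [hI a (hJ a ha) hna x, mul_zero]

lemma UE.add {X : Type} {T T' : ℝ → X → ℝ} {β β' : ℝ → X → ℝ} (h : UE T β) (h' : UE T' β') :
    UE (fun r x => T r x + T' r x) (fun a x => β a x + β' a x) := by
  classical
  obtain ⟨I, hI, hz, δ, hδ, C, hC⟩ := h
  obtain ⟨I', hI', hz', δ', hδ', C', hC'⟩ := h'
  have hJ : ∀ a ∈ I ∪ I', a < 0 := by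
    intro a ha
    rcases Finset.mem_union.1 ha with h | h
    exacts [hI a h, hI' a h]
  refine ⟨I ∪ I', hJ, ?_, min δ δ', lt_min hδ hδ', C + C', ?_⟩
  · intro a ha hna x
    rw [Finset.mem_union, not_or] at hna
    simp only
    rw [hz a ha hna.1, hz' a ha hna.2, add_zero]
  · intro r hr hrd x
    have h1 := hC r hr (hrd.trans_le (min_le_left _ _)) x
    have h2 := hC' r hr (hrd.trans_le (min_le_right _ _)) x
    rw [sum_enlarge (Finset.subset_union_left (s₂ := I')) hJ hz] at h1
    rw [sum_enlarge (Finset.subset_union_right (s₁ := I)) hJ hz'] at h2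
    simp only [mul_add, Finset.sum_add_distrib]
    have := abs_add_le (T r x - ∑ a ∈ I ∪ I', r ^ a * β a x) (T' r x - ∑ a ∈ I ∪ I', r ^ a * β' a x)
    refine le_trans (le_of_eq ?_) (this.trans (add_le_add h1 h2))
    congr 1; ring

lemma UE.const_mul {X : Type} {T : ℝ → X → ℝ} {β : ℝ → X → ℝ} (h : UE T β) (k : ℝ) :
    UE (fun r x => k * T r x) (fun a x => k * β a x) := by
  obtain ⟨I, hI, hz, δ, hδ, C, hC⟩ := h
  refine ⟨I, hI, ?_, δ, hδ, |k| * C, ?_⟩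
  · intro a ha hna x
    simp only; rw [hz a ha hna, mul_zero]
  · intro r hr hrd x
    have : k * T r x - ∑ a ∈ I, r ^ a * (k * β a x) = k * (T r x - ∑ a ∈ I, r ^ a * β a x) := by
      rw [mul_sub, Finset.mul_sum]
      congr 1
      refine Finset.sum_congr rfl fun a _ => by ring
    rw [this, abs_mul]
    exact mul_le_mul_of_nonneg_left (hC r hr hrd x) (abs_nonneg k)

lemma UE.congr {X : Type} {T T' : ℝ → X → ℝ} {β : ℝ → X → ℝ} (h : UE T β)
    (he : ∃ δ > 0, ∀ r, 0 < r → r < δ → ∀ x, T' r x = T r x) : UE T' β := by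
  obtain ⟨I, hI, hz, δ, hδ, C, hC⟩ := h
  obtain ⟨δ', hδ', he⟩ := he
  refine ⟨I, hI, hz, min δ δ', lt_min hδ hδ', C, ?_⟩
  intro r hr hrd x
  rw [he r hr (hrd.trans_le (min_le_right _ _))]
  exact hC r hr (hrd.trans_le (min_le_left _ _)) x

lemma UE.of_bounded {X : Type} {T : ℝ → X → ℝ}
    (h : ∃ δ > 0, ∃ C, ∀ r, 0 < r → r < δ → ∀ x, |T r x| ≤ C) : UE T (fun _ _ => 0) := by
  obtain ⟨δ, hδ, C, hC⟩ := h
  exact ⟨∅, by simp, by simp, δ, hδ, C, by simpa using hC⟩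

lemma UE.monomial {X : Type} (a : ℝ) (b : X → ℝ) (B : ℝ) (hb : ∀ x, |b x| ≤ B) :
    UE (fun r x => r ^ a * b x) (fun α x => if α = a then b x else 0) := by
  by_cases ha : a < 0
  · refine ⟨{a}, by simpa using ha, ?_, 1, one_pos, 0, ?_⟩
    · intro α _ hα x
      simp only [Finset.mem_singleton] at hα
      simp [hα]
    · intro r hr hr1 x
      simp
  · push Not at ha
    refine ⟨∅, by simp, ?_, 1, one_pos, B, ?_⟩
    · intro α hα _ x
      simp only
      rw [if_neg (by linarith)]
    · intro r hr hr1 x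
      simp only [Finset.sum_empty, sub_zero, abs_mul]
      rw [abs_of_pos (Real.rpow_pos_of_pos hr a)]
      have h1 : r ^ a ≤ 1 := Real.rpow_le_one hr.le hr1.le ha
      calc r ^ a * |b x| ≤ 1 * |b x| := by gcongr
        _ ≤ B := by rw [one_mul]; exact hb x

lemma UE.sum {X ι : Type} (s : Finset ι) (T : ι → ℝ → X → ℝ) (β : ι → ℝ → X → ℝ)
    (h : ∀ i ∈ s, UE (T i) (β i)) :
    UE (fun r x => ∑ i ∈ s, T i r x) (fun a x => ∑ i ∈ s, β i a x) := by
  classical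
  induction s using Finset.induction_on with
  | empty => simpa using UE.of_bounded (X := X) (T := fun _ _ => 0) ⟨1, one_pos, 0, by simp⟩
  | insert i s his ih =>
    have := (h i (Finset.mem_insert_self i s)).add (ih fun j hj => h j (Finset.mem_insert_of_mem hj))
    simpa only [Finset.sum_insert his] using this

lemma UE.at {X : Type} {T : ℝ → X → ℝ} {β : ℝ → X → ℝ} (h : UE T β) (x : X) :
    HasExp (fun r => T r x) (fun a => β a x) := by
  obtain ⟨I, hI, hz, δ, hδ, C, hC⟩ := h
  exact ⟨I, hI, fun a ha hna _ => hz a ha hna x, δ, hδ, C, fun r hr hrd _ => hC r hr hrd x⟩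

lemma exp_unique_aux (I : Finset ℝ) (e : ℝ → ℝ) (δ C : ℝ) (hδ : 0 < δ)
    (h : ∀ r, 0 < r → r < δ → |∑ a ∈ I, r ^ a * e a| ≤ C) (hI : ∀ a ∈ I, a < 0) :
    ∀ a ∈ I, e a = 0 := by
  classical
  by_contra hne
  push Not at hne
  set J := I.filter (fun a => e a ≠ 0) with hJ
  have hJn : J.Nonempty := by
    obtain ⟨a, ha, hea⟩ := hne
    exact ⟨a, Finset.mem_filter.2 ⟨ha, hea⟩⟩
  set m := J.min' hJn with hm
  have hmJ : m ∈ J := J.min'_mem hJn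
  have hmI : m ∈ I := (Finset.mem_filter.1 hmJ).1
  have hem : e m ≠ 0 := (Finset.mem_filter.1 hmJ).2
  have hm0 : m < 0 := hI m hmI
  have t1 : Tendsto (fun r : ℝ => r ^ (-m) * ∑ a ∈ I, r ^ a * e a) (𝓝[>] 0) (𝓝 (∑ a ∈ I, if a = m then e m else 0)) := by
    have : ∀ᶠ r : ℝ in 𝓝[>] 0, (∑ a ∈ I, r ^ (a - m) * e a) = r ^ (-m) * ∑ a ∈ I, r ^ a * e a := by
      filter_upwards [self_mem_nhdsWithin] with r hr
      have hr : 0 < r := hr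
      rw [Finset.mul_sum]
      refine Finset.sum_congr rfl fun a _ => ?_
      rw [← mul_assoc, ← Real.rpow_add hr]
      ring_nf
    refine Tendsto.congr' this ?_
    refine tendsto_finsetSum _ fun a ha => ?_
    by_cases ham : a = m
    · simp [ham]
    · rw [if_neg ham]
      by_cases hea : e a = 0
      · simp [hea]
      · have : m ≤ a := J.min'_le a (Finset.mem_filter.2 ⟨ha, hea⟩)
        have hlt : 0 < a - m := by
          rcases this.lt_or_eq with h | h
          · linarith
          · exact absurd h.symm ham
        have := ((Real.continuousAt_rpow_const 0 (a - m) (Or.inr hlt.le)).tendsto.mono_left nhdsWithin_le_nhds : Tendsto (fun r : ℝ => r ^ (a - m)) (𝓝[>] 0) _)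
        rw [Real.zero_rpow hlt.ne'] at this
        simpa using this.mul_const (e a)
  have t2 : Tendsto (fun r : ℝ => r ^ (-m) * ∑ a ∈ I, r ^ a * e a) (𝓝[>] 0) (𝓝 0) := by
    have t3 : Tendsto (fun r : ℝ => r ^ (-m) * C) (𝓝[>] 0) (𝓝 0) := by
      have := ((Real.continuousAt_rpow_const 0 (-m) (Or.inr (by linarith))).tendsto.mono_left nhdsWithin_le_nhds : Tendsto (fun r : ℝ => r ^ (-m)) (𝓝[>] 0) _)
      rw [Real.zero_rpow (by linarith)] at this
      simpa using this.mul_const C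
    refine squeeze_zero_norm' ?_ t3
    filter_upwards [self_mem_nhdsWithin, mem_nhdsWithin_of_mem_nhds (Iio_mem_nhds hδ)] with r hr hrd
    have hr : 0 < r := hr
    rw [norm_mul, Real.norm_of_nonneg (Real.rpow_nonneg hr.le _), Real.norm_eq_abs]
    exact mul_le_mul_of_nonneg_left (h r hr hrd) (Real.rpow_nonneg hr.le _)
  have := tendsto_nhds_unique t1 t2
  rw [Finset.sum_ite_eq' I m, if_pos hmI] at this
  exact hem this

lemma HasExp.unique {h P P' : ℝ → ℝ} (h1 : HasExp h P) (h2 : HasExp h P') :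
    ∀ a < 0, P a = P' a := by
  have h3 : UE (X := Unit) _ _ := UE.add h1 (UE.const_mul h2 (-1))
  obtain ⟨I, hI, hz, δ, hδ, C, hC⟩ := h3
  have := exp_unique_aux I (fun a => P a + -1 * P' a) δ C hδ (fun r hr hrd => by
    have := hC r hr hrd ()
    simpa using this) hI
  intro a ha
  by_cases haI : a ∈ I
  · have := this a haI
    linarith
  · have := hz a ha haI ()
    linarith

/-- subtraction terms -/
def SUB (σ s : ℝ) (P : ℝ → ℝ) : ℝ :=
  (∑ᶠ (a : ℝ) (_ : a < -3), s ^ (a + 3) / (a + 3) * P a) + Real.log (s / σ) * P (-3)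

def tm (σ s a : ℝ) : ℝ := if a < -3 then s ^ (a + 3) / (a + 3) else if a = -3 then Real.log (s / σ) else 0

def mm (σ ρ a : ℝ) : ℝ := if a = -3 then Real.log (ρ / σ) else ρ ^ (a + 3) / (a + 3)

lemma SUB_eq (σ s : ℝ) (P : ℝ → ℝ) (I : Finset ℝ)
    (hz : ∀ a, a < 0 → a ∉ I → P a = 0) : SUB σ s P = ∑ a ∈ I, tm σ s a * P a := by
  classical
  unfold SUB
  have e1 : (∑ᶠ (a : ℝ) (_ : a < -3), s ^ (a + 3) / (a + 3) * P a)
      = ∑ a ∈ I, if a < -3 then s ^ (a + 3) / (a + 3) * P a else 0 := by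
    have h0 : ∀ a : ℝ, (∑ᶠ (_ : a < -3), s ^ (a + 3) / (a + 3) * P a) = if a < -3 then s ^ (a + 3) / (a + 3) * P a else 0 := by
      intro a
      by_cases h : a < -3
      · simp [h]
      · simp [h]
    rw [finsum_congr h0]
    refine finsum_eq_sum_of_support_subset _ ?_
    intro a ha
    by_contra hna
    apply ha
    simp only
    split_ifs with h
    · rw [hz a (by linarith) hna, mul_zero]
    · rfl
  have e2 : Real.log (s / σ) * P (-3) = ∑ a ∈ I, if a = -3 then Real.log (s / σ) * P a else 0 := by
    rw [Finset.sum_ite_eq' I (-3 : ℝ) (fun a => Real.log (s / σ) * P a)]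
    split_ifs with h
    · rfl
    · rw [hz _ (by norm_num) h, mul_zero]
  rw [e1, e2, ← Finset.sum_add_distrib]
  refine Finset.sum_congr rfl fun a _ => ?_
  unfold tm
  by_cases h : a < -3
  · have : a ≠ -3 := h.ne
    simp [h, this]
  · by_cases h' : a = -3 <;> simp [h']


lemma SUB_congr (σ s : ℝ) {P P' : ℝ → ℝ} (h : ∀ a < 0, P a = P' a) : SUB σ s P = SUB σ s P' := by
  unfold SUB
  rw [h (-3) (by norm_num)]
  congr 1
  refine finsum_congr fun a => finsum_congr fun ha => ?_
  rw [h a (by linarith)]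

lemma HasExp.finite {h P : ℝ → ℝ} (hp : HasExp h P) : ∃ I : Finset ℝ, ∀ a, a < 0 → a ∉ I → P a = 0 := by
  obtain ⟨I, hI, hz, -⟩ := hp
  exact ⟨I, fun a ha hna => hz a ha hna ()⟩

lemma SUB_add {σ s : ℝ} {h h' P P' : ℝ → ℝ} (hp : HasExp h P) (hp' : HasExp h' P') :
    SUB σ s (fun a => P a + P' a) = SUB σ s P + SUB σ s P' := by
  classical
  obtain ⟨I, hI⟩ := hp.finite
  obtain ⟨I', hI'⟩ := hp'.finite
  rw [SUB_eq σ s P (I ∪ I') (fun a ha hna => hI a ha (fun h => hna (Finset.mem_union_left _ h))),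
    SUB_eq σ s P' (I ∪ I') (fun a ha hna => hI' a ha (fun h => hna (Finset.mem_union_right _ h))),
    SUB_eq σ s _ (I ∪ I') ?_, ← Finset.sum_add_distrib]
  · exact Finset.sum_congr rfl fun a _ => by ring
  · intro a ha hna
    rw [hI a ha (fun h => hna (Finset.mem_union_left _ h)), hI' a ha (fun h => hna (Finset.mem_union_right _ h)), add_zero]

lemma SUB_const_mul {σ s : ℝ} {h P : ℝ → ℝ} (hp : HasExp h P) (k : ℝ) :
    SUB σ s (fun a => k * P a) = k * SUB σ s P := by
  obtain ⟨I, hI⟩ := hp.finite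
  rw [SUB_eq σ s P I hI, SUB_eq σ s _ I ?_, Finset.mul_sum]
  · exact Finset.sum_congr rfl fun a _ => by ring
  · intro a ha hna
    rw [hI a ha hna, mul_zero]

lemma intervalIntegrable_rpow_pos (a s ρ : ℝ) (hs : 0 < s) (hρ : 0 < ρ) :
    IntervalIntegrable (fun r : ℝ => r ^ 2 * r ^ a) volume s ρ := by
  refine ContinuousOn.intervalIntegrable fun r hr => ?_
  have : 0 < r := (lt_min hs hρ).trans_le hr.1
  have h2 : ContinuousAt (fun r : ℝ => r ^ 2 * r ^ a) r := by
    have := Real.continuousAt_rpow_const r a (Or.inl this.ne')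
    fun_prop
  exact h2.continuousWithinAt

lemma integral_mono_mm (σ a s ρ : ℝ) (hσ : 0 < σ) (hs : 0 < s) (hsr : s ≤ ρ) :
    (∫ r in s..ρ, r ^ 2 * r ^ a) = mm σ ρ a - mm σ s a := by
  have hρ : 0 < ρ := hs.trans_le hsr
  have e : (∫ r in s..ρ, r ^ 2 * r ^ a) = ∫ r in s..ρ, r ^ (a + 2) := by
    refine intervalIntegral.integral_congr fun r hr => ?_
    have : 0 < r := (lt_min hs hρ).trans_le hr.1
    rw [Real.rpow_add this, mul_comm]
    norm_num
  rw [e]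
  have hnot : (0:ℝ) ∉ Set.uIcc s ρ := by
    rw [Set.uIcc_of_le hsr]
    intro h; linarith [h.1]
  unfold mm
  split_ifs with h
  · subst h
    have : ∀ r : ℝ, r ^ ((-3:ℝ) + 2) = r⁻¹ := by
      intro r; norm_num [Real.rpow_neg_one]
    simp_rw [this]
    rw [integral_inv hnot, Real.log_div hρ.ne' hs.ne', Real.log_div hρ.ne' hσ.ne', Real.log_div hs.ne' hσ.ne']
    ring
  · rw [integral_rpow (Or.inr ⟨fun h' => h (by linarith), hnot⟩)]
    rw [show a + 2 + 1 = a + 3 by ring]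
    ring

lemma mm_sub_tm (σ s a : ℝ) : mm σ s a - tm σ s a = if -3 < a then s ^ (a + 3) / (a + 3) else 0 := by
  unfold mm tm
  rcases lt_trichotomy a (-3) with h | h | h
  · simp [h, h.ne, not_lt.2 h.le]
  · simp [h]
  · simp [h, h.ne', not_lt.2 h.le]

/-- radial partie finie -/
def RPf (σ ρ : ℝ) (h P : ℝ → ℝ) (L : ℝ) : Prop :=
  HasExp h P ∧ (∀ s, 0 < s → s ≤ ρ → IntervalIntegrable (fun r => r ^ 2 * h r) volume s ρ) ∧
  Tendsto (fun s => (∫ r in s..ρ, r ^ 2 * h r) + SUB σ s P) (𝓝[>] 0) (𝓝 L)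

lemma eventually_Ioc (ρ : ℝ) (hρ : 0 < ρ) : ∀ᶠ s : ℝ in 𝓝[>] 0, 0 < s ∧ s ≤ ρ := by
  filter_upwards [self_mem_nhdsWithin, mem_nhdsWithin_of_mem_nhds (Iic_mem_nhds hρ)] with s hs hs'
  exact ⟨hs, hs'⟩

lemma RPf.monomial (σ ρ a : ℝ) (hσ : 0 < σ) (hρ : 0 < ρ) :
    RPf σ ρ (fun r => r ^ a) (fun α => if α = a then 1 else 0) (mm σ ρ a) := by
  refine ⟨?_, fun s hs _ => intervalIntegrable_rpow_pos a s ρ hs hρ, ?_⟩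
  · have := UE.monomial (X := Unit) a (fun _ => 1) 1 (by simp)
    simpa [HasExp] using this
  · have key : ∀ᶠ s : ℝ in 𝓝[>] 0, mm σ ρ a - (if -3 < a then s ^ (a + 3) / (a + 3) else 0) =
        (∫ r in s..ρ, r ^ 2 * r ^ a) + SUB σ s (fun α => if α = a then 1 else 0) := by
      filter_upwards [eventually_Ioc ρ hρ] with s hs
      rw [integral_mono_mm σ a s ρ hσ hs.1 hs.2, SUB_eq σ s _ {a} (by
        intro α _ h; simp at h; simp [h]), ← mm_sub_tm σ s a]
      simp
      ring
    refine Tendsto.congr' key ?_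
    by_cases h : -3 < a
    · simp only [h, if_true]
      have := ((Real.continuousAt_rpow_const 0 (a + 3) (Or.inr (by linarith))).tendsto.mono_left nhdsWithin_le_nhds : Tendsto (fun r : ℝ => r ^ (a + 3)) (𝓝[>] 0) _)
      rw [Real.zero_rpow (by linarith)] at this
      simpa using tendsto_const_nhds.sub (this.div_const (a + 3))
    · simp [h]

lemma RPf.add {σ ρ : ℝ} (hρ : 0 < ρ) {h P h' P' : ℝ → ℝ} {L L' : ℝ} (H : RPf σ ρ h P L) (H' : RPf σ ρ h' P' L') :
    RPf σ ρ (fun r => h r + h' r) (fun a => P a + P' a) (L + L') := by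
  refine ⟨UE.add H.1 H'.1, fun s hs hs' => ?_, ?_⟩
  · simp only [mul_add]
    exact (H.2.1 s hs hs').add (H'.2.1 s hs hs')
  · refine Tendsto.congr' ?_ (H.2.2.add H'.2.2)
    filter_upwards [eventually_Ioc ρ hρ] with s hs
    rw [SUB_add H.1 H'.1]
    simp only [mul_add]
    rw [intervalIntegral.integral_add (H.2.1 s hs.1 hs.2) (H'.2.1 s hs.1 hs.2)]
    ring

lemma RPf.const_mul {σ ρ : ℝ} {h P : ℝ → ℝ} {L : ℝ} (H : RPf σ ρ h P L) (k : ℝ) :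
    RPf σ ρ (fun r => k * h r) (fun a => k * P a) (k * L) := by
  refine ⟨UE.const_mul H.1 k, fun s hs hs' => ?_, ?_⟩
  · simp only [mul_left_comm _ k]
    exact (H.2.1 s hs hs').const_mul k
  · refine Tendsto.congr ?_ (H.2.2.const_mul k)
    intro s
    rw [SUB_const_mul H.1]
    simp only [mul_left_comm _ k]
    rw [intervalIntegral.integral_const_mul]
    ring

lemma RPf.sum {σ ρ : ℝ} (hρ : 0 < ρ) {ι : Type} (S : Finset ι) (h P : ι → ℝ → ℝ) (L : ι → ℝ)
    (H : ∀ i ∈ S, RPf σ ρ (h i) (P i) (L i)) :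
    RPf σ ρ (fun r => ∑ i ∈ S, h i r) (fun a => ∑ i ∈ S, P i a) (∑ i ∈ S, L i) := by
  classical
  induction S using Finset.induction_on with
  | empty =>
    refine ⟨?_, ?_, ?_⟩
    · simpa [HasExp] using UE.of_bounded (X := Unit) (T := fun _ _ => 0) ⟨1, one_pos, 0, by simp⟩
    · intro s _ _; simp
    · simp [SUB]
  | insert i s his ih =>
    have := RPf.add hρ (H i (Finset.mem_insert_self i s)) (ih fun j hj => H j (Finset.mem_insert_of_mem hj))
    simpa only [Finset.sum_insert his] using this

/-- bounded remainders -/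
lemma RPf.bounded {σ ρ : ℝ} (hρ : 0 < ρ) (h : ℝ → ℝ) (C : ℝ) (hC : ∀ r, 0 < r → r ≤ ρ → |h r| ≤ C)
    (hc : ContinuousOn h (Set.Ioc 0 ρ)) :
    ∃ L, RPf σ ρ h (fun _ => 0) L ∧ |L| ≤ C * ρ ^ 3 := by
  have hC0 : 0 ≤ C := (abs_nonneg _).trans (hC ρ hρ le_rfl)
  have hInteg : IntegrableOn (fun r => r ^ 2 * h r) (Set.Ioc 0 ρ) := by
    refine Integrable.of_bound (C := ρ ^ 2 * C) ?_ ?_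
    · exact ContinuousOn.aestronglyMeasurable (f := fun r => r ^ 2 * h r) ((continuousOn_id.pow 2).mul hc) measurableSet_Ioc
    · filter_upwards [ae_restrict_mem measurableSet_Ioc] with r hr
      rw [norm_mul, norm_pow, Real.norm_of_nonneg hr.1.le]
      gcongr
      · exact hr.1.le
      · exact hr.2
      · exact hC r hr.1 hr.2
  have hii : IntervalIntegrable (fun r => r ^ 2 * h r) volume 0 ρ :=
    (intervalIntegrable_iff_integrableOn_Ioc_of_le hρ.le).2 hInteg
  refine ⟨∫ r in 0..ρ, r ^ 2 * h r, ⟨?_, ?_, ?_⟩, ?_⟩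
  · exact UE.of_bounded (X := Unit) ⟨ρ, hρ, C, fun r hr hr' _ => hC r hr hr'.le⟩
  · intro s hs hs'
    refine hii.mono_set ?_
    rw [Set.uIcc_of_le hs', Set.uIcc_of_le hρ.le]
    exact Set.Icc_subset_Icc_left hs.le
  · have h1 : ∀ s, SUB σ s (fun _ => 0) = 0 := by intro s; simp [SUB]
    simp only [h1, add_zero]
    have hcont := intervalIntegral.continuousOn_primitive_interval_left (f := fun r => r ^ 2 * h r) (a := 0) (b := ρ) (μ := volume) (by
      rw [Set.uIcc_of_le hρ.le, integrableOn_Icc_iff_integrableOn_Ioc]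
      exact hInteg)
    have := (hcont 0 (by rw [Set.uIcc_of_le hρ.le]; exact ⟨le_rfl, hρ.le⟩)).tendsto
    rw [Set.uIcc_of_le hρ.le] at this
    refine this.mono_left ?_
    rw [nhdsWithin_le_iff]
    filter_upwards [eventually_Ioc ρ hρ] with s hs
    exact ⟨hs.1.le, hs.2⟩
  · have := intervalIntegral.norm_integral_le_of_norm_le_const (a := 0) (b := ρ) (f := fun r => r ^ 2 * h r) (C := ρ ^ 2 * C) (by
      intro r hr
      rw [Set.uIoc_of_le hρ.le] at hr
      rw [norm_mul, norm_pow, Real.norm_of_nonneg hr.1.le]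
      gcongr
      · exact hr.1.le
      · exact hr.2
      · exact hC r hr.1 hr.2)
    rw [sub_zero, abs_of_pos hρ] at this
    rw [← Real.norm_eq_abs]
    linarith [this]

/-- uniform bound for the differences -/
lemma UE.diff_bound {X : Type} {T : ℝ → X → ℝ} {β : ℝ → X → ℝ} (h : UE T β) (σ : ℝ) (hσ : 0 < σ)
    (hβ : ∀ a, ∃ B, ∀ x, |β a x| ≤ B) (ρ : ℝ) (hρ : 0 < ρ)
    (hInteg : ∀ x s, 0 < s → s ≤ ρ → IntervalIntegrable (fun r => r ^ 2 * T r x) volume s ρ) :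
    ∃ s₀ > 0, s₀ ≤ ρ ∧ ∀ t, 0 < t → t ≤ s₀ → ∃ C, ∀ s, 0 < s → s ≤ t → ∀ x,
      |(∫ r in s..t, r ^ 2 * T r x) + SUB σ s (fun a => β a x) - SUB σ t (fun a => β a x)| ≤ C := by
  obtain ⟨I, hI, hz, δ, hδ, C, hC⟩ := h
  choose B hB using hβ
  refine ⟨min (δ / 2) ρ, by positivity, min_le_right _ _, fun t ht htm => ?_⟩
  have htδ : t < δ := by
    have := htm.trans (min_le_left _ _)
    linarith
  have htρ : t ≤ ρ := htm.trans (min_le_right _ _)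
  refine ⟨t ^ 2 * C * t + ∑ a ∈ I, |t ^ (a + 3) / (a + 3)| * B a, fun s hs hst x => ?_⟩
  have hInteg' : IntervalIntegrable (fun r => r ^ 2 * T r x) volume s t := by
    refine (hInteg x s hs (hst.trans htρ)).mono_set ?_
    rw [Set.uIcc_of_le hst, Set.uIcc_of_le (hst.trans htρ)]
    exact Set.Icc_subset_Icc_right htρ
  have hC0 : 0 ≤ C := (abs_nonneg _).trans (hC t ht htδ x)
  rw [SUB_eq σ s _ I (fun a ha hna => hz a ha hna x), SUB_eq σ t _ I (fun a ha hna => hz a ha hna x)]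
  have hmono : ∀ a ∈ I, IntervalIntegrable (fun r : ℝ => r ^ 2 * (r ^ a * β a x)) volume s t := by
    intro a _
    have := (intervalIntegrable_rpow_pos a s t hs ht).mul_const (β a x)
    simpa only [mul_assoc] using this
  have hsumi : IntervalIntegrable (fun r : ℝ => ∑ a ∈ I, r ^ 2 * (r ^ a * β a x)) volume s t := by
    have := IntervalIntegrable.sum I (f := fun a (r : ℝ) => r ^ 2 * (r ^ a * β a x)) hmono
    have he : (fun r : ℝ => ∑ a ∈ I, r ^ 2 * (r ^ a * β a x)) = ∑ a ∈ I, fun r : ℝ => r ^ 2 * (r ^ a * β a x) := by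
      funext r; simp
    rw [he]; exact this
  have e1 : (∫ r in s..t, r ^ 2 * T r x) = (∫ r in s..t, r ^ 2 * (T r x - ∑ a ∈ I, r ^ a * β a x)) +
      ∑ a ∈ I, (mm σ t a - mm σ s a) * β a x := by
    have : ∀ a ∈ I, (mm σ t a - mm σ s a) * β a x = ∫ r in s..t, r ^ 2 * (r ^ a * β a x) := by
      intro a _
      rw [← integral_mono_mm σ a s t hσ hs hst, ← intervalIntegral.integral_mul_const]
      simp only [mul_assoc]
    rw [Finset.sum_congr rfl this, ← intervalIntegral.integral_finsetSum hmono]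
    simp only [mul_sub, Finset.mul_sum]
    rw [intervalIntegral.integral_sub hInteg' hsumi]
    ring
  have e2 : (∫ r in s..t, r ^ 2 * T r x) + (∑ a ∈ I, tm σ s a * β a x) - ∑ a ∈ I, tm σ t a * β a x =
      (∫ r in s..t, r ^ 2 * (T r x - ∑ a ∈ I, r ^ a * β a x)) +
      ∑ a ∈ I, ((mm σ t a - tm σ t a) - (mm σ s a - tm σ s a)) * β a x := by
    rw [e1, add_assoc, add_sub_assoc, ← Finset.sum_add_distrib, ← Finset.sum_sub_distrib]
    congr 1
    exact Finset.sum_congr rfl fun a _ => by ring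
  rw [e2]
  refine (abs_add_le _ _).trans (add_le_add ?_ ?_)
  · have := intervalIntegral.norm_integral_le_of_norm_le_const (a := s) (b := t) (f := fun r => r ^ 2 * (T r x - ∑ a ∈ I, r ^ a * β a x)) (C := t ^ 2 * C) (by
      intro r hr
      rw [Set.uIoc_of_le hst] at hr
      have hr0 : 0 < r := hs.trans hr.1
      rw [norm_mul, norm_pow, Real.norm_of_nonneg hr0.le]
      gcongr
      · exact hr.2
      · exact hC r hr0 (hr.2.trans_lt htδ) x)
    rw [← Real.norm_eq_abs]
    refine this.trans ?_
    rw [abs_of_nonneg (by linarith)]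
    gcongr
    linarith
  · refine (Finset.abs_sum_le_sum_abs _ _).trans (Finset.sum_le_sum fun a _ => ?_)
    rw [abs_mul]
    refine mul_le_mul ?_ (hB a x) (abs_nonneg _) (abs_nonneg _)
    rw [mm_sub_tm, mm_sub_tm]
    split_ifs with h
    · have h3 : 0 < a + 3 := by linarith
      have h1 : s ^ (a + 3) ≤ t ^ (a + 3) := Real.rpow_le_rpow hs.le hst h3.le
      have h2 : 0 ≤ s ^ (a + 3) := Real.rpow_nonneg hs.le _
      rw [← sub_div, abs_div, abs_div]
      gcongr
      linarith
    · simp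

lemma sqrt_taylor (M : ℕ) : ∃ b : ℕ → ℝ, ∃ δ > 0, ∃ C ≥ 0, ∀ z : ℝ, |z| < δ →
    |√(1 + z) - ∑ j ∈ Finset.range M, z ^ j * b j| ≤ C * |z| ^ M := by
  have h1 : AnalyticAt ℝ (fun z : ℝ => √(1 + z)) 0 := by
    have : ContDiffAt ℝ ⊤ (fun z : ℝ => √(1 + z)) 0 := by
      have h2 : ContDiffAt ℝ ⊤ (fun z : ℝ => 1 + z) 0 := by fun_prop
      exact h2.sqrt (by norm_num)
    exact this.analyticAt
  obtain ⟨p, hp⟩ := h1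
  have := hp.isBigO_sub_partialSum_pow M
  obtain ⟨C, hC0, hC⟩ := this.exists_nonneg
  rw [IsBigOWith] at hC
  obtain ⟨δ, hδ, hball⟩ := Metric.eventually_nhds_iff.1 hC
  refine ⟨fun j => p.coeff j, δ, hδ, C, hC0, fun z hz => ?_⟩
  have := hball (y := z) (by simpa using hz)
  simpa [FormalMultilinearSeries.partialSum, Real.norm_eq_abs] using this

lemma kernel_exp (v : S2 → E3) (hv : Continuous v) (R : ℝ) (hR : 0 < R) (hvR : ∀ n', R ≤ ‖v n'‖) (M : ℕ) :
    ∃ (D : ℕ) (κ : ℕ → C(S2 × S2, ℝ)) (δ : ℝ) (_ : 0 < δ) (C : ℝ), ∀ r, 0 < r → r < δ → ∀ n n' : S2,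
      |‖r • (n : E3) - v n'‖ - ∑ k ∈ Finset.range D, r ^ k * κ k (n, n')| ≤ C * r ^ M := by
  obtain ⟨b, δ, hδ, C, hC0, hC⟩ := sqrt_taylor M
  have hv0 : ∀ n', ‖v n'‖ ≠ 0 := fun n' => (hR.trans_le (hvR n')).ne'
  let A0 : C(S2 × S2, ℝ) := ⟨fun z => ‖v z.2‖, by fun_prop⟩
  let w : C(S2 × S2, ℝ) := ⟨fun z => (‖v z.2‖ ^ 2)⁻¹, by
    refine Continuous.inv₀ (by fun_prop) fun z => ?_
    exact pow_ne_zero _ (hv0 _)⟩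
  let u : C(S2 × S2, ℝ) := ⟨fun z => -2 * inner ℝ (z.1 : E3) (v z.2), by fun_prop⟩
  let p : Polynomial C(S2 × S2, ℝ) := ∑ j ∈ Finset.range M,
    Polynomial.C A0 * (Polynomial.X ^ 2 * Polynomial.C w + Polynomial.X * Polynomial.C (u * w)) ^ j *
      Polynomial.C (ContinuousMap.const _ (b j))
  obtain ⟨B, hB⟩ : ∃ B, ∀ n' : S2, ‖v n'‖ ≤ B := by
    obtain ⟨B, hB⟩ := (isCompact_range hv).isBounded.exists_norm_le
    exact ⟨B, fun n' => hB _ ⟨n', rfl⟩⟩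
  have hB0 : 0 ≤ B ∨ IsEmpty S2 := by
    by_cases h : Nonempty S2
    · obtain ⟨n⟩ := h; exact Or.inl ((norm_nonneg _).trans (hB n))
    · exact Or.inr (not_nonempty_iff.1 h)
  set q := (1 + 2 * B) / R ^ 2 with hq
  refine ⟨p.natDegree + 1, fun k => p.coeff k, min 1 (δ / (|q| + 1)), by positivity, B * (C * q ^ M), ?_⟩
  intro r hr hrd n n'
  have hr1 : r < 1 := hrd.trans_le (min_le_left _ _)
  have hB0 : 0 ≤ B := (norm_nonneg _).trans (hB n')
  have hq0 : 0 ≤ q := by positivity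
  have hrq : r * q < δ := by
    have h1 := hrd.trans_le (min_le_right _ _)
    rw [lt_div_iff₀ (by positivity), abs_of_nonneg hq0] at h1
    nlinarith
  have e1 : ∑ k ∈ Finset.range (p.natDegree + 1), r ^ k * p.coeff k (n, n') =
      (p.eval (ContinuousMap.const _ r)) (n, n') := by
    rw [Polynomial.eval_eq_sum_range]
    simp [ContinuousMap.sum_apply, mul_comm]
  set z := (r ^ 2 - 2 * r * inner ℝ (n : E3) (v n')) * (‖v n'‖ ^ 2)⁻¹ with hz
  have e2 : (p.eval (ContinuousMap.const _ r)) (n, n') = ‖v n'‖ * ∑ j ∈ Finset.range M, z ^ j * b j := by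
    simp only [p, Polynomial.eval_finsetSum, ContinuousMap.sum_apply, Finset.mul_sum]
    refine Finset.sum_congr rfl fun j _ => ?_
    simp [A0, w, u, hz]
    rw [mul_assoc]
    congr 3
    ring
  have hn : ‖(n : E3)‖ = 1 := norm_eq_of_mem_sphere n
  have hvp : 0 < ‖v n'‖ := hR.trans_le (hvR n')
  have e3 : ‖r • (n : E3) - v n'‖ = ‖v n'‖ * √(1 + z) := by
    rw [← Real.sqrt_sq (norm_nonneg (r • (n : E3) - v n')), norm_sub_sq_real, norm_smul, hn,
      inner_smul_left, Real.norm_of_nonneg hr.le]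
    nth_rewrite 2 [← Real.sqrt_sq hvp.le]
    rw [← Real.sqrt_mul (by positivity)]
    congr 1
    rw [hz]
    field_simp
    simp
    ring
  have hzb : |z| ≤ r * q := by
    rw [hz, abs_mul, abs_of_nonneg (a := (‖v n'‖ ^ 2)⁻¹) (by positivity), hq]
    have hi := abs_real_inner_le_norm (n : E3) (v n')
    rw [hn, one_mul] at hi
    have : |r ^ 2 - 2 * r * inner ℝ (n : E3) (v n')| ≤ r * (1 + 2 * B) := by
      have h2 := hi.trans (hB n')
      rw [abs_le] at h2 ⊢
      constructor <;> nlinarith [h2.1, h2.2]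
    rw [mul_div_assoc', div_eq_mul_inv]
    gcongr
    exact hvR n'
  rw [e1, e2, e3, ← mul_sub, abs_mul, abs_of_pos hvp]
  have hmain := hC z (hzb.trans_lt hrq)
  calc ‖v n'‖ * |√(1 + z) - ∑ j ∈ Finset.range M, z ^ j * b j| ≤ B * (C * |z| ^ M) := by
        gcongr
        exact hB n'
    _ ≤ B * (C * (r * q) ^ M) := by gcongr
    _ = B * (C * q ^ M) * r ^ M := by rw [mul_pow]; ring

lemma SmoothSphereFn.continuous {f : S2 → ℝ} (hf : SmoothSphereFn f) : Continuous f := by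
  obtain ⟨g, hg, hgf⟩ := hf
  have : f = fun n : S2 => g n := by funext n; exact (hgf n).symm
  rw [this]
  exact hg.continuous.comp continuous_subtype_val

lemma HasSingExpansion.trunc {y : E3} {F : E3 → ℝ} {c : ℝ → S2 → ℝ} (h : HasSingExpansion y F c) :
    ∃ A : Finset ℝ, (∀ a ∈ A, a ≤ 0) ∧ (∀ a, a ≤ 0 → a ∉ A → c a = 0) ∧ (∀ a ∈ A, c a ≠ 0) ∧
    ∃ δ > 0, ∀ r, 0 < r → r < δ → ∀ n : S2, |F (y + r • (n : E3)) - ∑ a ∈ A, r ^ a * c a n| ≤ 1 := by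
  have hfin := h.finite_exponents 0
  refine ⟨hfin.toFinset, ?_, ?_, ?_, ?_⟩
  · intro a ha; simp at ha; exact ha.1
  · intro a ha hna; simp at hna; exact hna ha
  · intro a ha; simp at ha; exact ha.2
  · obtain ⟨δ, hδ, H⟩ := h.expansion 0 1 one_pos
    refine ⟨δ, hδ, fun r hr hrd n => ?_⟩
    have := H r hr hrd n
    simp only [Nat.cast_zero, Real.rpow_zero, mul_one] at this
    have e : (∑ᶠ (a : ℝ) (_ : a ≤ 0), r ^ a * c a n) = ∑ a ∈ hfin.toFinset, r ^ a * c a n := by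
      have h0 : ∀ a : ℝ, (∑ᶠ (_ : a ≤ 0), r ^ a * c a n) = if a ≤ 0 then r ^ a * c a n else 0 := by
        intro a
        by_cases h : a ≤ 0
        · simp [h]
        · simp [h]
      rw [finsum_congr h0]
      rw [finsum_eq_sum_of_support_subset (s := hfin.toFinset)]
      · refine Finset.sum_congr rfl fun a ha => ?_
        simp at ha
        rw [if_pos ha.1]
      · intro a ha
        simp only [Function.mem_support, ne_eq, ite_eq_right_iff, not_forall] at ha
        obtain ⟨h1, h2⟩ := ha
        simp only [Set.Finite.coe_toFinset, Set.mem_ofPred_eq]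
        refine ⟨h1, fun hc => h2 ?_⟩
        rw [hc]; simp
    rwa [e] at this

lemma bound_sphere (f : S2 → ℝ) (hf : Continuous f) : ∃ B, ∀ x, |f x| ≤ B := by
  obtain ⟨B, hB⟩ := (isCompact_range hf).isBounded.exists_norm_le
  exact ⟨B, fun n' => hB _ ⟨n', rfl⟩⟩

lemma sphere_int_le (f : S2 → ℝ) (C : ℝ) (h : ∀ n, |f n| ≤ C) : |∫ n, f n ∂dOmega| ≤ C * (4 * π) := by
  rw [← dOmega_real_univ, ← Real.norm_eq_abs]
  exact norm_integral_le_of_norm_le_const (Eventually.of_forall fun n => h n)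

/-- the spherical integral of a function with a singular expansion -/
lemma HasSingExpansion.hasExp {y : E3} {F : E3 → ℝ} {c : ℝ → S2 → ℝ} (h : HasSingExpansion y F c)
    (hcont : ∃ ρ : ℝ, 0 < ρ ∧ ∀ r : ℝ, 0 < r → r < ρ → Continuous fun n : S2 => F (y + r • (n : E3))) :
    HasExp (fun r => ∫ n : S2, F (y + r • (n : E3)) ∂dOmega) (fun a => ∫ n : S2, c a n ∂dOmega) := by
  obtain ⟨A, hA0, hAz, -, δ, hδ, H⟩ := h.trunc
  obtain ⟨ρ, hρ, hcont⟩ := hcont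
  have hcc : ∀ a, Continuous (c a) := fun a => (h.smooth_coeffs a).continuous
  have h1 : UE (X := Unit) (fun r _ => ∑ a ∈ A, r ^ a * ∫ n : S2, c a n ∂dOmega)
      (fun α _ => ∑ a ∈ A, if α = a then ∫ n : S2, c a n ∂dOmega else 0) :=
    UE.sum (X := Unit) A (fun a r _ => r ^ a * ∫ n : S2, c a n ∂dOmega) _
      (fun a _ => UE.monomial a (fun _ => ∫ n : S2, c a n ∂dOmega) _ (fun _ => le_rfl))
  have h2 : UE (X := Unit) (fun r _ => (∫ n : S2, F (y + r • (n : E3)) ∂dOmega) - ∑ a ∈ A, r ^ a * ∫ n : S2, c a n ∂dOmega) (fun _ _ => 0) := by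
    refine UE.of_bounded ⟨min δ ρ, lt_min hδ hρ, 1 * (4 * π), fun r hr hrd _ => ?_⟩
    have hi : ∀ a ∈ A, Integrable (fun n => r ^ a * c a n) dOmega := fun a _ => (sphere_integrable (hcc a)).const_mul _
    have : (∑ a ∈ A, r ^ a * ∫ n : S2, c a n ∂dOmega) = ∫ n, ∑ a ∈ A, r ^ a * c a n ∂dOmega := by
      rw [integral_finsetSum _ hi]
      exact Finset.sum_congr rfl fun a _ => (integral_const_mul _ _).symm
    rw [this, ← integral_sub (sphere_integrable (hcont r hr (hrd.trans_le (min_le_right _ _)))) (integrable_finsetSum _ hi)]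
    exact sphere_int_le _ _ (fun n => H r hr (hrd.trans_le (min_le_left _ _)) n)
  have h3 := h1.add h2
  obtain ⟨I, hI, hz, δ', hδ', C, hC⟩ := h3
  have hβ : ∀ α < 0, (∑ a ∈ A, if α = a then ∫ n : S2, c a n ∂dOmega else 0) + 0 = ∫ n : S2, c α n ∂dOmega := by
    intro α hα
    rw [Finset.sum_ite_eq A α (fun a => ∫ n : S2, c a n ∂dOmega), add_zero]
    split_ifs with h
    · rfl
    · rw [hAz α hα.le h]; simp
  refine ⟨I, hI, fun a ha hna _ => ?_, δ', hδ', C, fun r hr hrd x => ?_⟩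
  · show (∫ n : S2, c a n ∂dOmega) = 0
    rw [← hβ a ha]; exact hz a ha hna ()
  · have := hC r hr hrd x
    simp only at this
    rw [add_sub_cancel] at this
    have e5 : (∑ a ∈ I, r ^ a * ∫ n : S2, c a n ∂dOmega) = ∑ x ∈ I, r ^ x * ((∑ a ∈ A, if x = a then ∫ (n : S2), c a n ∂dOmega else 0) + 0) :=
      Finset.sum_congr rfl fun a ha => by rw [hβ a (hI a ha)]
    rw [← e5] at this
    exact this

lemma UE_kernel {y : E3} {F : E3 → ℝ} {c : ℝ → S2 → ℝ} (h : HasSingExpansion y F c)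
    (hcont : ∃ ρ : ℝ, 0 < ρ ∧ ∀ r : ℝ, 0 < r → r < ρ → Continuous fun n : S2 => F (y + r • (n : E3)))
    (X : S2 → E3) (hX : Continuous X) (R : ℝ) (hR : 0 < R) (hXR : ∀ n', R ≤ ‖X n' - y‖) :
    ∃ β : ℝ → S2 → ℝ, (∀ a, Continuous (β a)) ∧
      UE (fun r n' => ∫ n : S2, ‖(y + r • (n : E3)) - X n'‖ * F (y + r • (n : E3)) ∂dOmega) β := by
  classical
  obtain ⟨A, hA0, hAz, hAn, δ, hδ, H⟩ := h.trunc
  obtain ⟨ρ, hρ, hcont⟩ := hcont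
  have hcc : ∀ a, Continuous (c a) := fun a => (h.smooth_coeffs a).continuous
  choose Bc hBc using fun a => bound_sphere (c a) (hcc a)
  obtain ⟨M, hM⟩ : ∃ M : ℕ, ∀ a ∈ A, -(M:ℝ) ≤ a := by
    obtain ⟨a₀, ha₀⟩ := h.bddBelow
    obtain ⟨M, hM⟩ := exists_nat_gt (-a₀)
    refine ⟨M, fun a ha => ?_⟩
    by_contra hlt
    exact hAn a ha (ha₀ a (by linarith))
  obtain ⟨D, κ, δ', hδ', C, hC⟩ := kernel_exp (fun n' => X n' - y) (by fun_prop) R hR hXR M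
  obtain ⟨Bv, hBv⟩ := bound_sphere (fun n' => ‖X n' - y‖) (by fun_prop)
  let b : ℕ × ℝ → S2 → ℝ := fun p n' => ∫ n : S2, κ p.1 (n, n') * c p.2 n ∂dOmega
  have hbc : ∀ p, Continuous (b p) := by
    intro p
    have := continuous_parametric_integral_of_continuous (μ := dOmega) (s := Set.univ)
      (f := fun n' n : S2 => κ p.1 (n, n') * c p.2 n) (by
        have := hcc p.2
        simp only [Function.uncurry_def]
        fun_prop) isCompact_univ
    simpa using this
  choose Bb hBb using fun p => bound_sphere (b p) (hbc p)
  have hInteg : ∀ (p : ℕ × ℝ) (n' : S2), Integrable (fun n => κ p.1 (n, n') * c p.2 n) dOmega := by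
    intro p n'
    have := hcc p.2
    exact sphere_integrable (by fun_prop)
  refine ⟨fun α n' => (∑ p ∈ Finset.range D ×ˢ A, if α = (p.1:ℝ) + p.2 then b p n' else 0) + 0, ?_, ?_⟩
  · intro α
    refine Continuous.add (continuous_finsetSum _ fun p _ => ?_) continuous_const
    split_ifs
    · exact hbc p
    · exact continuous_const
  have h1 : UE (fun r n' => ∑ p ∈ Finset.range D ×ˢ A, r ^ ((p.1:ℝ) + p.2) * b p n')
      (fun α n' => ∑ p ∈ Finset.range D ×ˢ A, if α = (p.1:ℝ) + p.2 then b p n' else 0) :=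
    UE.sum (Finset.range D ×ˢ A) (fun p r n' => r ^ ((p.1:ℝ) + p.2) * b p n') _
      (fun p _ => UE.monomial ((p.1:ℝ) + p.2) (b p) (Bb p) (hBb p))
  have h2 : UE (fun r n' => (∫ n : S2, ‖(y + r • (n : E3)) - X n'‖ * F (y + r • (n : E3)) ∂dOmega)
      - ∑ p ∈ Finset.range D ×ˢ A, r ^ ((p.1:ℝ) + p.2) * b p n') (fun _ _ => 0) := by
    refine UE.of_bounded ⟨min (min 1 ρ) (min δ δ'), by positivity,
      ((1 + Bv) * 1 + |C| * ∑ a ∈ A, |Bc a|) * (4 * π), fun r hr hrd n' => ?_⟩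
    simp only [lt_min_iff] at hrd
    obtain ⟨⟨hr1, hrρ⟩, hrδ, hrδ'⟩ := hrd
    have e1 : (∑ p ∈ Finset.range D ×ˢ A, r ^ ((p.1:ℝ) + p.2) * b p n') =
        ∫ n, ∑ p ∈ Finset.range D ×ˢ A, r ^ ((p.1:ℝ) + p.2) * (κ p.1 (n, n') * c p.2 n) ∂dOmega := by
      rw [integral_finsetSum _ fun p _ => (hInteg p n').const_mul _]
      exact Finset.sum_congr rfl fun p _ => (integral_const_mul _ _).symm
    have hFc := hcont r hr hrρ
    have hKF : Continuous (fun n : S2 => ‖(y + r • (n : E3)) - X n'‖ * F (y + r • (n : E3))) :=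
      Continuous.mul (by fun_prop) hFc
    rw [e1, ← integral_sub (sphere_integrable hKF)
      (integrable_finsetSum _ fun p _ => (hInteg p n').const_mul _)]
    refine sphere_int_le _ _ fun n => ?_
    have e2 : (∑ p ∈ Finset.range D ×ˢ A, r ^ ((p.1:ℝ) + p.2) * (κ p.1 (n, n') * c p.2 n)) =
        (∑ k ∈ Finset.range D, r ^ k * κ k (n, n')) * ∑ a ∈ A, r ^ a * c a n := by
      rw [Finset.sum_mul_sum, Finset.sum_product]
      refine Finset.sum_congr rfl fun k _ => Finset.sum_congr rfl fun a _ => ?_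
      rw [Real.rpow_add hr, Real.rpow_natCast]
      ring
    have e3 : (y + r • (n : E3)) - X n' = r • (n : E3) - (X n' - y) := by abel
    rw [e2, e3]
    have k1 := hC r hr hrδ' n n'
    have k2 := H r hr hrδ n
    have hn : ‖(n : E3)‖ = 1 := norm_eq_of_mem_sphere n
    have k3 : ‖r • (n : E3) - (X n' - y)‖ ≤ 1 + Bv := by
      refine (norm_sub_le _ _).trans ?_
      rw [norm_smul, hn, Real.norm_of_nonneg hr.le]
      have := hBv n'
      rw [abs_of_nonneg (norm_nonneg _)] at this
      linarith
    have k4 : r ^ M * |∑ a ∈ A, r ^ a * c a n| ≤ ∑ a ∈ A, |Bc a| := by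
      rw [← abs_of_pos (pow_pos hr M), ← abs_mul, Finset.mul_sum]
      refine (Finset.abs_sum_le_sum_abs _ _).trans (Finset.sum_le_sum fun a ha => ?_)
      have : r ^ M * (r ^ a * c a n) = r ^ ((M:ℝ) + a) * c a n := by
        rw [Real.rpow_add hr, Real.rpow_natCast]; ring
      rw [this, abs_mul]
      have h5 : |r ^ ((M:ℝ) + a)| ≤ 1 := by
        rw [abs_of_pos (Real.rpow_pos_of_pos hr _)]
        exact Real.rpow_le_one hr.le hr1.le (by linarith [hM a ha])
      have h6 := (hBc a n).trans (le_abs_self _)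
      calc _ ≤ 1 * |Bc a| := by gcongr
        _ = _ := one_mul _
    have hK0 := norm_nonneg (r • (n : E3) - (X n' - y))
    generalize ‖r • (n : E3) - (X n' - y)‖ = K at *
    generalize (∑ a ∈ A, r ^ a * c a n) = SF at *
    generalize (∑ k ∈ Finset.range D, r ^ k * κ k (n, n')) = SK at *
    have : K * F (y + r • (n : E3)) - SK * SF = K * (F (y + r • (n : E3)) - SF) + (K - SK) * SF := by ring
    rw [this]
    refine (abs_add_le _ _).trans (add_le_add ?_ ?_)
    · rw [abs_mul]
      refine mul_le_mul ?_ k2 (abs_nonneg _) (hK0.trans k3)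
      rwa [abs_of_nonneg hK0]
    · rw [abs_mul]
      calc |K - SK| * |SF| ≤ (|C| * r ^ M) * |SF| := by
            gcongr
            refine k1.trans ?_
            gcongr
            exact le_abs_self C
        _ = |C| * (r ^ M * |SF|) := by ring
        _ ≤ _ := by gcongr
  exact (h1.add h2).congr ⟨1, one_pos, fun r _ _ n' => by simp⟩

def outS (y₁ y₂ : E3) (s : ℝ) : Set E3 := (Metric.closedBall y₁ s ∪ Metric.closedBall y₂ s)ᶜ

def Sph (y : E3) (g : E3 → ℝ) (r : ℝ) : ℝ := ∫ n : S2, g (y + r • (n : E3)) ∂dOmega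

lemma outS_meas (y₁ y₂ : E3) (s : ℝ) : MeasurableSet (outS y₁ y₂ s) :=
  (Metric.isClosed_closedBall.union Metric.isClosed_closedBall).measurableSet.compl

lemma outS_sub (y₁ y₂ : E3) (s : ℝ) (hs : 0 < s) : outS y₁ y₂ s ⊆ ({y₁, y₂}ᶜ : Set E3) := by
  intro x hx
  simp only [outS, Set.mem_compl_iff, Set.mem_union, Metric.mem_closedBall, not_or, not_le] at hx
  simp only [Set.mem_compl_iff, Set.mem_insert_iff, Set.mem_singleton_iff, not_or]
  refine ⟨?_, ?_⟩ <;> rintro rfl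
  · have := hx.1; rw [dist_self] at this; linarith
  · have := hx.2; rw [dist_self] at this; linarith

lemma out_integrable (y₁ y₂ : E3) (F : E3 → ℝ) (hFc : ContinuousOn F ({y₁, y₂}ᶜ : Set E3)) (η : ℝ) (hη : 0 < η)
    (hdecay : ∃ C R : ℝ, ∀ x : E3, R ≤ ‖x‖ → |F x| ≤ C * ‖x‖ ^ (-5 - η)) (s : ℝ) (hs : 0 < s) :
    IntegrableOn (fun x => (1 + ‖x‖) * F x) (outS y₁ y₂ s) := by
  obtain ⟨C, R, hC⟩ := hdecay
  set R' := max R 1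
  have hK : IsCompact (Metric.closedBall (0:E3) R' \ (Metric.ball y₁ s ∪ Metric.ball y₂ s)) :=
    (isCompact_closedBall _ _).diff (Metric.isOpen_ball.union Metric.isOpen_ball)
  have hgc : ContinuousOn (fun x => (1 + ‖x‖) * F x) ({y₁, y₂}ᶜ : Set E3) :=
    ContinuousOn.mul (by fun_prop) hFc
  have h1 : IntegrableOn (fun x => (1 + ‖x‖) * F x) (Metric.closedBall (0:E3) R' \ (Metric.ball y₁ s ∪ Metric.ball y₂ s)) := by
    refine ContinuousOn.integrableOn_compact hK (hgc.mono ?_)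
    rintro x ⟨-, hx⟩
    simp only [Set.mem_compl_iff, Set.mem_insert_iff, Set.mem_singleton_iff, not_or]
    refine ⟨?_, ?_⟩ <;> rintro rfl
    · exact hx (Or.inl (Metric.mem_ball_self hs))
    · exact hx (Or.inr (Metric.mem_ball_self hs))
  have h2 : IntegrableOn (fun x => (1 + ‖x‖) * F x) (outS y₁ y₂ s ∩ (Metric.closedBall (0:E3) R')ᶜ) := by
    have hm : MeasurableSet (outS y₁ y₂ s ∩ (Metric.closedBall (0:E3) R')ᶜ) :=
      (outS_meas _ _ _).inter Metric.isClosed_closedBall.measurableSet.compl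
    have hI : Integrable (fun x : E3 => (|C| * (1/2:ℝ) ^ (-5 - η)) * (1 + ‖x‖) ^ (-(4 + η))) volume :=
      (integrable_one_add_norm (by simp; linarith)).const_mul _
    refine Integrable.mono' hI.integrableOn
      ((hgc.mono (Set.inter_subset_left.trans (outS_sub _ _ _ hs))).aestronglyMeasurable hm) ?_
    refine (ae_restrict_iff' hm).2 (Eventually.of_forall fun x hx => ?_)
    have hx2 : R' < ‖x‖ := by
      have := hx.2
      simpa using this
    have hx1 : 1 < ‖x‖ := (le_max_right _ _).trans_lt hx2
    have hx3 := hC x ((le_max_left _ _).trans hx2.le)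
    rw [Real.norm_eq_abs, abs_mul, abs_of_pos (by positivity : 0 < 1 + ‖x‖)]
    have e1 : ‖x‖ ^ (-5 - η) ≤ (1/2:ℝ) ^ (-5 - η) * (1 + ‖x‖) ^ (-5 - η) := by
      rw [← Real.mul_rpow (by norm_num) (by positivity)]
      exact Real.rpow_le_rpow_of_nonpos (by positivity) (by linarith) (by linarith)
    have e2 : (1 + ‖x‖) ^ (-(4 + η)) = (1 + ‖x‖) * (1 + ‖x‖) ^ (-5 - η) := by
      rw [← Real.rpow_one_add' (by positivity) (by linarith)]
      congr 1; ring
    rw [e2]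
    calc (1 + ‖x‖) * |F x| ≤ (1 + ‖x‖) * (|C| * ((1/2:ℝ) ^ (-5 - η) * (1 + ‖x‖) ^ (-5 - η))) := by
          gcongr
          refine hx3.trans ?_
          gcongr
          exact le_abs_self C
      _ = _ := by ring
  refine (h1.union h2).mono_set ?_
  intro x hx
  by_cases hb : x ∈ Metric.closedBall (0:E3) R'
  · refine Or.inl ⟨hb, fun h => ?_⟩
    rcases h with h | h
    · exact hx (Or.inl (Metric.ball_subset_closedBall h))
    · exact hx (Or.inr (Metric.ball_subset_closedBall h))
  · exact Or.inr ⟨hx, hb⟩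

lemma out_integrable_mul (y₁ y₂ : E3) (F : E3 → ℝ) (hFc : ContinuousOn F ({y₁, y₂}ᶜ : Set E3))
    (s : ℝ) (hs : 0 < s) (h : IntegrableOn (fun x => (1 + ‖x‖) * F x) (outS y₁ y₂ s))
    (K : E3 → ℝ) (hK : ContinuousOn K (outS y₁ y₂ s)) (B : ℝ) (hB : ∀ x ∈ outS y₁ y₂ s, |K x| ≤ B * (1 + ‖x‖)) :
    IntegrableOn (fun x => K x * F x) (outS y₁ y₂ s) := by
  have hm := outS_meas y₁ y₂ s
  refine Integrable.mono' (g := fun x => B * ‖(1 + ‖x‖) * F x‖) (h.norm.const_mul B)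
    ((hK.mul (hFc.mono (outS_sub _ _ _ hs))).aestronglyMeasurable hm) ?_
  refine (ae_restrict_iff' hm).2 (Eventually.of_forall fun x hx => ?_)
  rw [Real.norm_eq_abs, abs_mul, Real.norm_eq_abs, abs_mul, abs_of_pos (by positivity : 0 < 1 + ‖x‖), ← mul_assoc]
  exact mul_le_mul_of_nonneg_right (hB x hx) (abs_nonneg _)

lemma sph_mem1 (y₁ y₂ : E3) (r : ℝ) (hr : 0 < r) (hr' : r < ‖y₁ - y₂‖) (n : S2) :
    y₁ + r • (n : E3) ∈ ({y₁, y₂}ᶜ : Set E3) := by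
  have hn : ‖(n : E3)‖ = 1 := norm_eq_of_mem_sphere n
  have h1 : ‖r • (n : E3)‖ = r := by rw [norm_smul, hn, Real.norm_of_nonneg hr.le, mul_one]
  simp only [Set.mem_compl_iff, Set.mem_insert_iff, Set.mem_singleton_iff, not_or]
  refine ⟨fun h => ?_, fun h => ?_⟩
  · have : r • (n : E3) = 0 := by simpa using h
    rw [this, norm_zero] at h1; linarith
  · have : y₁ - y₂ = -(r • (n : E3)) := by rw [← h]; abel
    rw [this, norm_neg, h1] at hr'; linarith

lemma sph_mem2 (y₁ y₂ : E3) (r : ℝ) (hr : 0 < r) (hr' : r < ‖y₁ - y₂‖) (n : S2) :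
    y₂ + r • (n : E3) ∈ ({y₁, y₂}ᶜ : Set E3) := by
  rw [Set.pair_comm]
  exact sph_mem1 y₂ y₁ r hr (by rwa [norm_sub_rev]) n

lemma cont_sph {U : Set E3} {g : E3 → ℝ} (hg : ContinuousOn g U) (y : E3) (r : ℝ)
    (hU : ∀ n : S2, y + r • (n : E3) ∈ U) : Continuous fun n : S2 => g (y + r • (n : E3)) :=
  hg.comp_continuous (by fun_prop) hU

lemma Sph_continuousOn {U : Set E3} {g : E3 → ℝ} (hg : ContinuousOn g U) (y : E3) (S : Set ℝ)
    (hS : LocallyCompactSpace S) (hU : ∀ r ∈ S, ∀ n : S2, y + r • (n : E3) ∈ U) : ContinuousOn (Sph y g) S := by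
  rw [continuousOn_iff_continuous_restrict]
  have := continuous_parametric_integral_of_continuous (μ := dOmega) (s := Set.univ)
      (f := fun (r : S) (n : S2) => g (y + (r:ℝ) • (n : E3))) (by
        simp only [Function.uncurry_def]
        exact hg.comp_continuous (by fun_prop) (fun p => hU _ p.1.2 _)) isCompact_univ
  simpa [Set.restrict_def, Sph] using this

lemma out_split (y₁ y₂ : E3) (g : E3 → ℝ) (s t : ℝ) (hs : 0 < s) (hst : s ≤ t) (ht : 2 * t < ‖y₁ - y₂‖)
    (hg : IntegrableOn g (outS y₁ y₂ s)) :
    ∫ x in outS y₁ y₂ s, g x = (∫ x in outS y₁ y₂ t, g x) + (∫ r in s..t, r ^ 2 * Sph y₁ g r)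
      + ∫ r in s..t, r ^ 2 * Sph y₂ g r := by
  have hdist : ∀ x, t < dist x y₁ ∨ t < dist x y₂ := by
    intro x
    by_contra! h
    have h2 := dist_triangle_left y₁ y₂ x
    rw [dist_eq_norm] at h2
    linarith [h.1, h.2]
  have hcover : outS y₁ y₂ s = (outS y₁ y₂ t ∪ (Metric.closedBall y₁ t \ Metric.closedBall y₁ s)) ∪
      (Metric.closedBall y₂ t \ Metric.closedBall y₂ s) := by
    ext x
    simp only [outS, Set.mem_compl_iff, Set.mem_union, Metric.mem_closedBall, not_or, not_le, Set.mem_sdiff]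
    have := hdist x
    constructor
    · rintro ⟨h1, h2⟩
      by_cases h3 : dist x y₁ ≤ t
      · exact Or.inl (Or.inr ⟨h3, h1⟩)
      · by_cases h4 : dist x y₂ ≤ t
        · exact Or.inr ⟨h4, h2⟩
        · exact Or.inl (Or.inl ⟨not_le.1 h3, not_le.1 h4⟩)
    · rintro ((⟨h1, h2⟩ | ⟨h1, h2⟩) | ⟨h1, h2⟩)
      · exact ⟨by linarith, by linarith⟩
      · exact ⟨h2, by rcases this with h | h <;> linarith⟩
      · exact ⟨by rcases this with h | h <;> linarith, h2⟩
  have hm1 : MeasurableSet (Metric.closedBall y₁ t \ Metric.closedBall y₁ s) :=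
    Metric.isClosed_closedBall.measurableSet.diff Metric.isClosed_closedBall.measurableSet
  have hm2 : MeasurableSet (Metric.closedBall y₂ t \ Metric.closedBall y₂ s) :=
    Metric.isClosed_closedBall.measurableSet.diff Metric.isClosed_closedBall.measurableSet
  have hg' := hg
  rw [hcover] at hg'
  have g1 := hg'.left_of_union.left_of_union
  have g2 := hg'.left_of_union.right_of_union
  have g3 := hg'.right_of_union
  rw [hcover, setIntegral_union _ hm2 (g1.union g2) g3, setIntegral_union _ hm1 g1 g2,
    polar_annulus y₁ g s t hs.le hst g2, polar_annulus y₂ g s t hs.le hst g3]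
  · rfl
  · rw [Set.disjoint_left]
    intro x hx h2
    exact hx (Or.inl h2.1)
  · rw [Set.disjoint_left]
    rintro x (hx | hx) h2
    · exact hx (Or.inr h2.1)
    · have h3 := hx.1; have h4 := h2.1
      rw [Metric.mem_closedBall] at h3 h4
      rcases hdist x with h | h <;> linarith

def GPf (y₁ y₂ : E3) (s₁ s₂ : ℝ) (g : E3 → ℝ) (L : ℝ) : Prop :=
  ∃ P1 P2 : ℝ → ℝ, HasExp (Sph y₁ g) P1 ∧ HasExp (Sph y₂ g) P2 ∧
    Tendsto (fun s => (∫ x in outS y₁ y₂ s, g x) + SUB s₁ s P1 + SUB s₂ s P2) (𝓝[>] 0) (𝓝 L)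

lemma HasExp.congr {h h' P : ℝ → ℝ} (H : HasExp h P) (he : ∃ δ > 0, ∀ r, 0 < r → r < δ → h' r = h r) : HasExp h' P := by
  obtain ⟨δ, hδ, he⟩ := he
  exact UE.congr H ⟨δ, hδ, fun r hr hrd _ => he r hr hrd⟩

lemma HasExp.add {h h' P P' : ℝ → ℝ} (H : HasExp h P) (H' : HasExp h' P') :
    HasExp (fun r => h r + h' r) (fun a => P a + P' a) := UE.add (X := Unit) H H'

lemma HasExp.const_mul {h P : ℝ → ℝ} (H : HasExp h P) (k : ℝ) :
    HasExp (fun r => k * h r) (fun a => k * P a) := UE.const_mul (X := Unit) H k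

lemma hcont1 {y₁ y₂ : E3} (hy : y₁ ≠ y₂) {g : E3 → ℝ} (hg : ContinuousOn g ({y₁, y₂}ᶜ : Set E3)) :
    ∃ ρ : ℝ, 0 < ρ ∧ ∀ r : ℝ, 0 < r → r < ρ → Continuous fun n : S2 => g (y₁ + r • (n : E3)) :=
  ⟨‖y₁ - y₂‖, norm_pos_iff.2 (sub_ne_zero.2 hy), fun _ hr hr' => cont_sph hg _ _ (sph_mem1 _ _ _ hr hr')⟩

lemma hcont2 {y₁ y₂ : E3} (hy : y₁ ≠ y₂) {g : E3 → ℝ} (hg : ContinuousOn g ({y₁, y₂}ᶜ : Set E3)) :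
    ∃ ρ : ℝ, 0 < ρ ∧ ∀ r : ℝ, 0 < r → r < ρ → Continuous fun n : S2 => g (y₂ + r • (n : E3)) :=
  ⟨‖y₁ - y₂‖, norm_pos_iff.2 (sub_ne_zero.2 hy), fun _ hr hr' => cont_sph hg _ _ (sph_mem2 _ _ _ hr hr')⟩

lemma pfApprox_eq (y₁ y₂ : E3) (s₁ s₂ : ℝ) (g : E3 → ℝ) (p q : ℝ → S2 → ℝ) (s : ℝ) :
    pfApprox y₁ y₂ s₁ s₂ g p q s = (∫ x in outS y₁ y₂ s, g x) + SUB s₁ s (fun a => ∫ n, p a n ∂dOmega)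
      + SUB s₂ s (fun a => ∫ n, q a n ∂dOmega) := by
  unfold pfApprox SUB outS
  ring

lemma GPf.of_Pf {y₁ y₂ : E3} (hy : y₁ ≠ y₂) {s₁ s₂ : ℝ} {g : E3 → ℝ} (hg : ContinuousOn g ({y₁, y₂}ᶜ : Set E3)) {p q : ℝ → S2 → ℝ} {L : ℝ}
    (hp : HasSingExpansion y₁ g p) (hq : HasSingExpansion y₂ g q) (h : HasPfIntegral y₁ y₂ s₁ s₂ g p q L) :
    GPf y₁ y₂ s₁ s₂ g L := by
  refine ⟨_, _, hp.hasExp (hcont1 hy hg), hq.hasExp (hcont2 hy hg), ?_⟩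
  refine h.congr fun s => pfApprox_eq _ _ _ _ _ _ _ _

lemma GPf.congr {y₁ y₂ : E3} (hy : y₁ ≠ y₂) {s₁ s₂ : ℝ} {g g' : E3 → ℝ} {L : ℝ} (h : GPf y₁ y₂ s₁ s₂ g L)
    (he : ∀ x ∈ ({y₁, y₂}ᶜ : Set E3), g' x = g x) : GPf y₁ y₂ s₁ s₂ g' L := by
  obtain ⟨P1, P2, h1, h2, h3⟩ := h
  have hd : 0 < ‖y₁ - y₂‖ := norm_pos_iff.2 (sub_ne_zero.2 hy)
  refine ⟨P1, P2, h1.congr ⟨_, hd, fun r hr hr' => ?_⟩, h2.congr ⟨_, hd, fun r hr hr' => ?_⟩, h3.congr' ?_⟩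
  · exact integral_congr_ae (Eventually.of_forall fun n => he _ (sph_mem1 _ _ _ hr hr' n))
  · exact integral_congr_ae (Eventually.of_forall fun n => he _ (sph_mem2 _ _ _ hr hr' n))
  · filter_upwards [self_mem_nhdsWithin] with s hs
    rw [setIntegral_congr_fun (outS_meas _ _ _) fun x hx => he x (outS_sub _ _ _ hs hx)]

lemma GPf.add_mul {y₁ y₂ : E3} (hy : y₁ ≠ y₂) {s₁ s₂ : ℝ} {g g' : E3 → ℝ} {L L' : ℝ} (h : GPf y₁ y₂ s₁ s₂ g L)
    (h' : GPf y₁ y₂ s₁ s₂ g' L')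
    (hg : ContinuousOn g ({y₁, y₂}ᶜ : Set E3)) (hg' : ContinuousOn g' ({y₁, y₂}ᶜ : Set E3))
    (hi : ∀ s, 0 < s → IntegrableOn g (outS y₁ y₂ s)) (hi' : ∀ s, 0 < s → IntegrableOn g' (outS y₁ y₂ s))
    (k k' : ℝ) :
    GPf y₁ y₂ s₁ s₂ (fun x => k * g x + k' * g' x) (k * L + k' * L') := by
  obtain ⟨P1, P2, h1, h2, h3⟩ := h
  obtain ⟨P1', P2', h1', h2', h3'⟩ := h'
  have hd : 0 < ‖y₁ - y₂‖ := norm_pos_iff.2 (sub_ne_zero.2 hy)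
  have a1 := h1.const_mul k
  have a2 := h2.const_mul k
  have a1' := h1'.const_mul k'
  have a2' := h2'.const_mul k'
  have b1 := a1.add a1'
  have b2 := a2.add a2'
  refine ⟨fun a => k * P1 a + k' * P1' a, fun a => k * P2 a + k' * P2' a,
    b1.congr ⟨_, hd, fun r hr hr' => ?_⟩, b2.congr ⟨_, hd, fun r hr hr' => ?_⟩, ?_⟩
  · have c := cont_sph hg y₁ r (sph_mem1 _ _ _ hr hr')
    have c' := cont_sph hg' y₁ r (sph_mem1 _ _ _ hr hr')
    simp only [Sph]
    rw [integral_add ((sphere_integrable c).const_mul _) ((sphere_integrable c').const_mul _),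
      integral_const_mul, integral_const_mul]
  · have c := cont_sph hg y₂ r (sph_mem2 _ _ _ hr hr')
    have c' := cont_sph hg' y₂ r (sph_mem2 _ _ _ hr hr')
    simp only [Sph]
    rw [integral_add ((sphere_integrable c).const_mul _) ((sphere_integrable c').const_mul _),
      integral_const_mul, integral_const_mul]
  · refine Tendsto.congr' ?_ ((h3.const_mul k).add (h3'.const_mul k'))
    filter_upwards [self_mem_nhdsWithin] with s hs
    rw [integral_add ((hi s hs).const_mul _) ((hi' s hs).const_mul _),
      integral_const_mul, integral_const_mul, SUB_add a1 a1', SUB_add a2 a2', SUB_const_mul h1,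
      SUB_const_mul h2, SUB_const_mul h1', SUB_const_mul h2']
    ring

lemma UE.SUB_cont {T β : ℝ → S2 → ℝ} (h : UE T β) (hβ : ∀ a, Continuous (β a)) (σ s : ℝ) :
    Continuous (fun n' => SUB σ s (fun a => β a n')) ∧
    ∫ n', SUB σ s (fun a => β a n') ∂dOmega = SUB σ s (fun a => ∫ n', β a n' ∂dOmega) := by
  obtain ⟨I, hI, hz, -⟩ := h
  have e : ∀ n', SUB σ s (fun a => β a n') = ∑ a ∈ I, tm σ s a * β a n' := fun n' =>
    SUB_eq σ s _ I (fun a ha hna => hz a ha hna n')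
  simp only [e]
  refine ⟨continuous_finsetSum _ fun a _ => (hβ a).const_mul _, ?_⟩
  rw [integral_finsetSum _ fun a _ => (sphere_integrable (hβ a)).const_mul _, SUB_eq σ s _ I]
  · exact Finset.sum_congr rfl fun a _ => integral_const_mul _ _
  · intro a ha hna
    simp [hz a ha hna]

lemma UE.integrate {T β : ℝ → S2 → ℝ} (h : UE T β) (hβ : ∀ a, Continuous (β a))
    (hT : ∃ δ > 0, ∀ r, 0 < r → r < δ → Continuous (T r)) :
    HasExp (fun r => ∫ n', T r n' ∂dOmega) (fun a => ∫ n', β a n' ∂dOmega) := by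
  obtain ⟨I, hI, hz, δ, hδ, C, hC⟩ := h
  obtain ⟨δ', hδ', hT⟩ := hT
  refine ⟨I, hI, fun a ha hna _ => ?_, min δ δ', lt_min hδ hδ', C * (4 * π), fun r hr hrd _ => ?_⟩
  · simp [hz a ha hna]
  · have hi : ∀ a ∈ I, Integrable (fun n => r ^ a * β a n) dOmega := fun a _ => (sphere_integrable (hβ a)).const_mul _
    have e : (∑ a ∈ I, r ^ a * ∫ n', β a n' ∂dOmega) = ∫ n', ∑ a ∈ I, r ^ a * β a n' ∂dOmega := by
      rw [integral_finsetSum _ hi]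
      exact Finset.sum_congr rfl fun a _ => (integral_const_mul _ _).symm
    simp only
    rw [e, ← integral_sub (sphere_integrable (hT r hr (hrd.trans_le (min_le_right _ _)))) (integrable_finsetSum _ hi)]
    exact sphere_int_le _ _ fun n' => hC r hr (hrd.trans_le (min_le_left _ _)) n'

lemma avg_kernel (y₁ x : E3) (hx : x ≠ y₁) (r' : ℝ) (hr' : 0 < r') (k : ℝ) :
    ∫ n' : S2, ‖x - (y₁ + r' • (n' : E3))‖ * k ∂dOmega = 4 * π * Mavg ‖x - y₁‖ r' * k := by
  rw [integral_mul_const, ← avg_dist (x - y₁) r' hr' (sub_ne_zero.2 hx)]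
  simp only [sub_sub]

/-- continuity in the parameter and Fubini on the sphere -/
lemma sph_swap {U : Set E3} {F : E3 → ℝ} (hF : ContinuousOn F U) (y y₁ : E3) (r r' : ℝ) (hr' : 0 < r')
    (hU : ∀ n : S2, y + r • (n : E3) ∈ U) (hU1 : ∀ n : S2, y + r • (n : E3) ≠ y₁) :
    Continuous (fun n' : S2 => ∫ n : S2, ‖(y + r • (n : E3)) - (y₁ + r' • (n' : E3))‖ * F (y + r • (n : E3)) ∂dOmega) ∧
    ∫ n' : S2, (∫ n : S2, ‖(y + r • (n : E3)) - (y₁ + r' • (n' : E3))‖ * F (y + r • (n : E3)) ∂dOmega) ∂dOmega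
      = Sph y (fun x => 4 * π * Mavg ‖x - y₁‖ r' * F x) r := by
  have hc := cont_sph hF y r hU
  have hc2 : Continuous (fun p : S2 × S2 => ‖(y + r • (p.2 : E3)) - (y₁ + r' • (p.1 : E3))‖ * F (y + r • (p.2 : E3))) := 
    Continuous.mul (by fun_prop) (hc.comp continuous_snd)
  constructor
  · have := continuous_parametric_integral_of_continuous (μ := dOmega) (s := Set.univ)
      (f := fun (n' n : S2) => ‖(y + r • (n : E3)) - (y₁ + r' • (n' : E3))‖ * F (y + r • (n : E3))) hc2 isCompact_univ
    simpa using this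
  · rw [integral_integral_swap]
    · unfold Sph
      refine integral_congr_ae (Eventually.of_forall fun n => ?_)
      exact avg_kernel y₁ _ (hU1 n) r' hr' _
    · exact hc2.integrable_of_hasCompactSupport (HasCompactSupport.of_compactSpace _)

lemma J_swap (y₁ y₂ : E3) (F : E3 → ℝ) (hFc : ContinuousOn F ({y₁, y₂}ᶜ : Set E3))
    (s : ℝ) (hs : 0 < s) (h : IntegrableOn (fun x => (1 + ‖x‖) * F x) (outS y₁ y₂ s)) (r' : ℝ) (hr' : 0 < r') :
    Continuous (fun n' : S2 => ∫ x in outS y₁ y₂ s, ‖x - (y₁ + r' • (n' : E3))‖ * F x) ∧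
    ∫ n' : S2, (∫ x in outS y₁ y₂ s, ‖x - (y₁ + r' • (n' : E3))‖ * F x) ∂dOmega =
      ∫ x in outS y₁ y₂ s, 4 * π * Mavg ‖x - y₁‖ r' * F x := by
  have hm := outS_meas y₁ y₂ s
  have hFm : AEStronglyMeasurable F (volume.restrict (outS y₁ y₂ s)) :=
    (hFc.mono (outS_sub _ _ _ hs)).aestronglyMeasurable hm
  set B := ‖y₁‖ + r' + 1
  have hb : ∀ (n' : S2) (x : E3), ‖‖x - (y₁ + r' • (n' : E3))‖ * F x‖ ≤ B * ‖(1 + ‖x‖) * F x‖ := by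
    intro n' x
    have hn : ‖(n' : E3)‖ = 1 := norm_eq_of_mem_sphere n'
    rw [norm_mul, norm_mul, norm_norm, ← mul_assoc, Real.norm_of_nonneg (by positivity : 0 ≤ 1 + ‖x‖)]
    refine mul_le_mul_of_nonneg_right ?_ (norm_nonneg _)
    have h1 : ‖x - (y₁ + r' • (n' : E3))‖ ≤ ‖x‖ + (‖y₁‖ + r') := by
      refine (norm_sub_le _ _).trans (add_le_add le_rfl ((norm_add_le _ _).trans ?_))
      rw [norm_smul, hn, Real.norm_of_nonneg hr'.le, mul_one]
    refine h1.trans ?_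
    have := norm_nonneg x
    have := norm_nonneg y₁
    simp only [B]
    nlinarith
  have hbi : Integrable (fun x => B * ‖(1 + ‖x‖) * F x‖) (volume.restrict (outS y₁ y₂ s)) := h.norm.const_mul B
  constructor
  · refine continuous_of_dominated (bound := fun x => B * ‖(1 + ‖x‖) * F x‖) (fun n' => ?_) (fun n' => ?_) hbi ?_
    · exact (by fun_prop : Continuous fun x : E3 => ‖x - (y₁ + r' • (n' : E3))‖).aestronglyMeasurable.mul hFm
    · exact Eventually.of_forall fun x => hb n' x
    · exact Eventually.of_forall fun x => by fun_prop
  · rw [integral_integral_swap]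
    · refine setIntegral_congr_fun hm fun x hx => ?_
      have := outS_sub _ _ _ hs hx
      simp only [Set.mem_compl_iff, Set.mem_insert_iff, Set.mem_singleton_iff, not_or] at this
      exact avg_kernel y₁ x this.1 r' hr' (F x)
    · refine Integrable.mono' (hbi.comp_snd dOmega) ?_ (Eventually.of_forall fun p => hb p.1 p.2)
      exact (by fun_prop : Continuous fun p : S2 × E3 => ‖p.2 - (y₁ + r' • (p.1 : E3))‖).aestronglyMeasurable.mul hFm.comp_snd

lemma avg_GPf (y₁ y₂ : E3) (hy : y₁ ≠ y₂) (s₁ s₂ : ℝ) (hs₁ : 0 < s₁) (hs₂ : 0 < s₂)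
    (F : E3 → ℝ) (c d : ℝ → S2 → ℝ) (hF : MemF y₁ y₂ F c d)
    (hInteg : ∀ s, 0 < s → IntegrableOn (fun x => (1 + ‖x‖) * F x) (outS y₁ y₂ s))
    (Q : E3 → ℝ)
    (hQ : ∀ x' : E3, x' ≠ y₁ → x' ≠ y₂ →
      ∃ p q : ℝ → S2 → ℝ,
        HasSingExpansion y₁ (fun x => ‖x - x'‖ * F x) p
        ∧ HasSingExpansion y₂ (fun x => ‖x - x'‖ * F x) q
        ∧ HasPfIntegral y₁ y₂ s₁ s₂ (fun x => ‖x - x'‖ * F x) p q (-(4 * π) * Q x'))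
    (r' : ℝ) (hr' : 0 < r') (hrd : r' < ‖y₁ - y₂‖) :
    GPf y₁ y₂ s₁ s₂ (fun x => 4 * π * Mavg ‖x - y₁‖ r' * F x) (∫ n' : S2, -(4 * π) * Q (y₁ + r' • (n' : E3)) ∂dOmega) := by
  have hd : 0 < ‖y₁ - y₂‖ := norm_pos_iff.2 (sub_ne_zero.2 hy)
  have hFc : ContinuousOn F ({y₁, y₂}ᶜ : Set E3) := hF.smooth.continuousOn
  have hKc : ∀ x', ContinuousOn (fun x => ‖x - x'‖ * F x) ({y₁, y₂}ᶜ : Set E3) := fun x' =>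
    ContinuousOn.mul (by fun_prop) hFc
  have hXn : ∀ n' : S2, ‖r' • (n' : E3)‖ = r' := by
    intro n'
    rw [norm_smul, norm_eq_of_mem_sphere n', Real.norm_of_nonneg hr'.le, mul_one]
  obtain ⟨β1, hβ1c, U1⟩ := UE_kernel hF.exp₁ (hcont1 hy hFc) (fun n' : S2 => y₁ + r' • (n' : E3)) (by fun_prop) r' hr'
    (fun n' => by rw [add_sub_cancel_left, hXn])
  obtain ⟨β2, hβ2c, U2⟩ := UE_kernel hF.exp₂ (hcont2 hy hFc) (fun n' : S2 => y₁ + r' • (n' : E3)) (by fun_prop)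
    (‖y₁ - y₂‖ - r') (by linarith) (fun n' => by
      have := norm_sub_norm_le (y₁ - y₂) (-(r' • (n' : E3)))
      rw [norm_neg, hXn] at this
      refine this.trans (le_of_eq ?_)
      congr 1; abel)
  have hKint : ∀ s, 0 < s → ∀ n' : S2, IntegrableOn (fun x => ‖x - (y₁ + r' • (n' : E3))‖ * F x) (outS y₁ y₂ s) := by
    intro s hs n'
    refine out_integrable_mul y₁ y₂ F hFc s hs (hInteg s hs) _ (by fun_prop) (‖y₁‖ + r' + 1) fun x _ => ?_
    rw [abs_of_nonneg (norm_nonneg _)]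
    have h1 : ‖x - (y₁ + r' • (n' : E3))‖ ≤ ‖x‖ + (‖y₁‖ + r') := by
      refine (norm_sub_le _ _).trans (add_le_add le_rfl ((norm_add_le _ _).trans ?_))
      rw [hXn]
    refine h1.trans ?_
    have := norm_nonneg x
    have := norm_nonneg y₁
    nlinarith
  set A : ℝ → S2 → ℝ := fun s n' => (∫ x in outS y₁ y₂ s, ‖x - (y₁ + r' • (n' : E3))‖ * F x)
    + SUB s₁ s (fun a => β1 a n') + SUB s₂ s (fun a => β2 a n') with hAdef
  have hA : ∀ n' : S2, Tendsto (fun s => A s n') (𝓝[>] 0) (𝓝 (-(4 * π) * Q (y₁ + r' • (n' : E3)))) := by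
    intro n'
    have hmem := sph_mem1 y₁ y₂ r' hr' hrd n'
    simp only [Set.mem_compl_iff, Set.mem_insert_iff, Set.mem_singleton_iff, not_or] at hmem
    obtain ⟨p, q, hp, hq, hpq⟩ := hQ _ hmem.1 hmem.2
    refine hpq.congr fun s => ?_
    rw [pfApprox_eq, hAdef]
    rw [SUB_congr s₁ s ((hp.hasExp (hcont1 hy (hKc _))).unique (U1.at n')),
      SUB_congr s₂ s ((hq.hasExp (hcont2 hy (hKc _))).unique (U2.at n'))]
  have hAc : ∀ s, 0 < s → Continuous (A s) := fun s hs =>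
    (((J_swap y₁ y₂ F hFc s hs (hInteg s hs) r' hr').1).add (U1.SUB_cont hβ1c s₁ s).1).add (U2.SUB_cont hβ2c s₂ s).1
  have hρ : 0 < ‖y₁ - y₂‖ / 4 := by positivity
  have hSphint : ∀ (y : E3) (g : E3 → ℝ), ContinuousOn g ({y₁, y₂}ᶜ : Set E3) →
      (∀ r, 0 < r → r < ‖y₁ - y₂‖ → ∀ n : S2, y + r • (n : E3) ∈ ({y₁, y₂}ᶜ : Set E3)) →
      ∀ s, 0 < s → s ≤ ‖y₁ - y₂‖ / 4 → IntervalIntegrable (fun r => r ^ 2 * Sph y g r) volume s (‖y₁ - y₂‖ / 4) := by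
    intro y g hg hU s hs hs'
    refine ContinuousOn.intervalIntegrable ?_
    rw [Set.uIcc_of_le hs']
    refine ContinuousOn.mul (by fun_prop) (Sph_continuousOn hg y _ inferInstance fun r hr n => hU r ?_ ?_ n)
    · exact hs.trans_le hr.1
    · have := hr.2; linarith
  obtain ⟨t1, ht1, ht1', H1⟩ := U1.diff_bound s₁ hs₁ (fun a => bound_sphere _ (hβ1c a)) _ hρ
    (fun n' s hs hs' => hSphint y₁ _ (hKc (y₁ + r' • (n' : E3))) (sph_mem1 y₁ y₂) s hs hs')
  obtain ⟨t2, ht2, ht2', H2⟩ := U2.diff_bound s₂ hs₂ (fun a => bound_sphere _ (hβ2c a)) _ hρ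
    (fun n' s hs hs' => hSphint y₂ _ (hKc (y₁ + r' • (n' : E3))) (sph_mem2 y₁ y₂) s hs hs')
  set t := min t1 t2
  have ht : 0 < t := lt_min ht1 ht2
  have htd : 2 * t < ‖y₁ - y₂‖ := by
    have : t ≤ t1 := min_le_left _ _
    linarith
  obtain ⟨C1, hC1⟩ := H1 t ht (min_le_left _ _)
  obtain ⟨C2, hC2⟩ := H2 t ht (min_le_right _ _)
  obtain ⟨B, hB⟩ := bound_sphere _ (hAc t ht)
  have hbd : ∀ s, 0 < s → s ≤ t → ∀ n', |A s n'| ≤ B + C1 + C2 := by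
    intro s hs hst n'
    have k1 := hC1 s hs hst n'
    have k2 := hC2 s hs hst n'
    have k3 := hB n'
    have e := out_split y₁ y₂ _ s t hs hst htd (hKint s hs n')
    have e2 : A s n' = A t n' + ((∫ r in s..t, r ^ 2 * Sph y₁ (fun x => ‖x - (y₁ + r' • (n' : E3))‖ * F x) r) + SUB s₁ s (fun a => β1 a n') - SUB s₁ t (fun a => β1 a n'))
      + ((∫ r in s..t, r ^ 2 * Sph y₂ (fun x => ‖x - (y₁ + r' • (n' : E3))‖ * F x) r) + SUB s₂ s (fun a => β2 a n') - SUB s₂ t (fun a => β2 a n')) := by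
      simp only [hAdef]
      rw [e]; ring
    rw [e2]
    exact (abs_add_le _ _).trans (add_le_add ((abs_add_le _ _).trans (add_le_add k3 k1)) k2)
  have hlim : Tendsto (fun s => ∫ n', A s n' ∂dOmega) (𝓝[>] 0) (𝓝 (∫ n' : S2, -(4 * π) * Q (y₁ + r' • (n' : E3)) ∂dOmega)) := by
    refine tendsto_integral_filter_of_dominated_convergence (fun _ => B + C1 + C2) ?_ ?_ (integrable_const _) ?_
    · filter_upwards [self_mem_nhdsWithin] with s hs
      exact (hAc s hs).aestronglyMeasurable
    · filter_upwards [eventually_Ioc t ht] with s hs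
      exact Eventually.of_forall fun n' => hbd s hs.1 hs.2 n'
    · exact Eventually.of_forall hA
  have sw1 : ∀ r, 0 < r → r < ‖y₁ - y₂‖ → _ := fun r hr hrd => sph_swap hFc y₁ y₁ r r' hr' (sph_mem1 y₁ y₂ r hr hrd)
    (fun n h => sph_mem1 y₁ y₂ r hr hrd n (by simp [h]))
  have sw2 : ∀ r, 0 < r → r < ‖y₁ - y₂‖ → _ := fun r hr hrd => sph_swap hFc y₂ y₁ r r' hr' (sph_mem2 y₁ y₂ r hr hrd)
    (fun n h => sph_mem2 y₁ y₂ r hr hrd n (by simp [h]))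
  refine ⟨fun a => ∫ n', β1 a n' ∂dOmega, fun a => ∫ n', β2 a n' ∂dOmega, ?_, ?_, ?_⟩
  · exact (U1.integrate hβ1c ⟨_, hd, fun r hr hrd => (sw1 r hr hrd).1⟩).congr
      ⟨_, hd, fun r hr hrd => (sw1 r hr hrd).2.symm⟩
  · exact (U2.integrate hβ2c ⟨_, hd, fun r hr hrd => (sw2 r hr hrd).1⟩).congr
      ⟨_, hd, fun r hr hrd => (sw2 r hr hrd).2.symm⟩
  · refine hlim.congr' ?_
    filter_upwards [self_mem_nhdsWithin] with s hs
    have j := J_swap y₁ y₂ F hFc s hs (hInteg s hs) r' hr'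
    have k1 := U1.SUB_cont hβ1c s₁ s
    have k2 := U2.SUB_cont hβ2c s₂ s
    simp only [hAdef]
    have hjk : Integrable (fun n' : S2 => (∫ x in outS y₁ y₂ s, ‖x - (y₁ + r' • (n' : E3))‖ * F x)
        + SUB s₁ s (fun a => β1 a n')) dOmega := (sphere_integrable j.1).add (sphere_integrable k1.1)
    rw [integral_add hjk (sphere_integrable k2.1),
      integral_add (sphere_integrable j.1) (sphere_integrable k1.1), j.2, k1.2, k2.2]

lemma Mavg_eq (r r' : ℝ) : Mavg r r' = max r r' + min r r' ^ 2 / (3 * max r r') := by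
  unfold Mavg
  split_ifs with h
  · rw [max_eq_right h, min_eq_left h]
  · rw [max_eq_left (not_le.1 h).le, min_eq_right (not_le.1 h).le]

lemma Mavg_cont (r' : ℝ) (hr' : 0 < r') : Continuous (fun r => Mavg r r') := by
  simp only [Mavg_eq]
  refine Continuous.add (by fun_prop) (Continuous.div (by fun_prop) (by fun_prop) fun r => ?_)
  have : 0 < max r r' := lt_max_of_lt_right hr'
  positivity

lemma Mavg_bound (r r' : ℝ) (hr : 0 ≤ r) (hr' : 0 < r') : |Mavg r r'| ≤ r + 2 * r' := by
  unfold Mavg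
  split_ifs with h
  · rw [abs_of_nonneg (by positivity)]
    have : r ^ 2 / (3 * r') ≤ r' := by
      rw [div_le_iff₀ (by positivity)]
      nlinarith
    linarith
  · push Not at h
    rw [abs_of_nonneg (by positivity)]
    have : r' ^ 2 / (3 * r) ≤ r' := by
      rw [div_le_iff₀ (by linarith)]
      nlinarith
    linarith

def Gd (y₁ : E3) (F : E3 → ℝ) (r' : ℝ) (x : E3) : ℝ := (Mavg ‖x - y₁‖ r' - ‖x - y₁‖) * F x

lemma diff_GPf (y₁ y₂ : E3) (hy : y₁ ≠ y₂) (s₁ s₂ : ℝ) 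
    (F : E3 → ℝ) (hFc : ContinuousOn F ({y₁, y₂}ᶜ : Set E3))
    (hInteg : ∀ s, 0 < s → IntegrableOn (fun x => (1 + ‖x‖) * F x) (outS y₁ y₂ s))
    (r' : ℝ) (hr' : 0 < r') (I q : ℝ)
    (h1 : GPf y₁ y₂ s₁ s₂ (fun x => 4 * π * Mavg ‖x - y₁‖ r' * F x) (-(4 * π) * I))
    (h2 : GPf y₁ y₂ s₁ s₂ (fun x => ‖x - y₁‖ * F x) (-(4 * π) * q)) :
    GPf y₁ y₂ s₁ s₂ (Gd y₁ F r') (- I + 4 * π * q) ∧ (∀ s, 0 < s → IntegrableOn (Gd y₁ F r') (outS y₁ y₂ s)) := by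
  have hMc := Mavg_cont r' hr'
  have hMc2 : Continuous (fun x : E3 => 4 * π * Mavg ‖x - y₁‖ r') :=
    (hMc.comp (by fun_prop : Continuous fun x : E3 => ‖x - y₁‖)).const_mul _
  have hnb : ∀ x : E3, ‖x - y₁‖ ≤ ‖x‖ + ‖y₁‖ := fun x => norm_sub_le _ _
  have i1 : ∀ s, 0 < s → IntegrableOn (fun x => 4 * π * Mavg ‖x - y₁‖ r' * F x) (outS y₁ y₂ s) := by
    intro s hs
    refine out_integrable_mul y₁ y₂ F hFc s hs (hInteg s hs) _ hMc2.continuousOn (4 * π * (1 + ‖y₁‖ + 2 * r')) fun x _ => ?_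
    rw [abs_mul, abs_of_pos (by positivity : (0:ℝ) < 4 * π), mul_assoc (4 * π) _ (1 + ‖x‖)]
    refine mul_le_mul_of_nonneg_left ?_ (by positivity)
    refine (Mavg_bound _ _ (norm_nonneg _) hr').trans ?_
    have := hnb x
    have := norm_nonneg x
    have := norm_nonneg y₁
    nlinarith
  have i2 : ∀ s, 0 < s → IntegrableOn (fun x => ‖x - y₁‖ * F x) (outS y₁ y₂ s) := by
    intro s hs
    refine out_integrable_mul y₁ y₂ F hFc s hs (hInteg s hs) _ (by fun_prop) (1 + ‖y₁‖) fun x _ => ?_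
    rw [abs_of_nonneg (norm_nonneg _)]
    have := hnb x
    have := norm_nonneg x
    have := norm_nonneg y₁
    nlinarith
  have e0 : Gd y₁ F r' = fun x => (4 * π)⁻¹ * (4 * π * Mavg ‖x - y₁‖ r' * F x) + (-1) * (‖x - y₁‖ * F x) := by
    funext x
    unfold Gd
    field_simp
    ring
  constructor
  · have h3 := GPf.add_mul hy h1 h2 (hMc2.continuousOn.mul hFc) (ContinuousOn.mul (by fun_prop) hFc) i1 i2 (4 * π)⁻¹ (-1)
    rw [e0]
    convert h3 using 1
    field_simp
  · intro s hs
    rw [e0]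
    exact ((i1 s hs).const_mul _).add ((i2 s hs).const_mul _)

def Fr (y₁ : E3) (F : E3 → ℝ) (x : E3) : ℝ := F x / ‖x - y₁‖

lemma Gd_far (y₁ : E3) (F : E3 → ℝ) (r' : ℝ) (x : E3) (hr' : 0 < r') (h : r' < ‖x - y₁‖) :
    Gd y₁ F r' x = r' ^ 2 / 3 * Fr y₁ F x := by
  unfold Gd Fr Mavg
  rw [if_neg (not_le.2 h)]
  have : ‖x - y₁‖ ≠ 0 := (hr'.trans h).ne'
  field_simp
  ring

lemma Gd_near (y₁ : E3) (F : E3 → ℝ) (r' r : ℝ) (hr : 0 < r) (h : r ≤ r') :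
    Sph y₁ (Gd y₁ F r') r = (r' + r ^ 2 / (3 * r') - r) * Sph y₁ F r := by
  unfold Sph
  rw [← integral_const_mul]
  refine integral_congr_ae (Eventually.of_forall fun n => ?_)
  have hn : ‖y₁ + r • (n : E3) - y₁‖ = r := by
    rw [add_sub_cancel_left, norm_smul, norm_eq_of_mem_sphere n, Real.norm_of_nonneg hr.le, mul_one]
  simp only [Gd, Mavg]
  rw [hn, if_pos h]

lemma Fr_near (y₁ : E3) (F : E3 → ℝ) (r : ℝ) (hr : 0 < r) :
    r ^ 2 * Sph y₁ (Fr y₁ F) r = r * Sph y₁ F r := by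
  have : Sph y₁ (Fr y₁ F) r = Sph y₁ F r / r := by
    unfold Sph
    rw [← integral_div]
    refine integral_congr_ae (Eventually.of_forall fun n => ?_)
    have hn : ‖y₁ + r • (n : E3) - y₁‖ = r := by
      rw [add_sub_cancel_left, norm_smul, norm_eq_of_mem_sphere n, Real.norm_of_nonneg hr.le, mul_one]
    simp only [Fr]
    rw [hn]
  rw [this]
  field_simp

lemma Gd_y2 (y₁ y₂ : E3) (F : E3 → ℝ) (r' r : ℝ) (hr' : 0 < r') (hr : 0 < r) (h : r + r' < ‖y₁ - y₂‖) :
    Sph y₂ (Gd y₁ F r') r = r' ^ 2 / 3 * Sph y₂ (Fr y₁ F) r := by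
  unfold Sph
  rw [← integral_const_mul]
  refine integral_congr_ae (Eventually.of_forall fun n => ?_)
  refine Gd_far y₁ F r' _ hr' ?_
  have hn : ‖r • (n : E3)‖ = r := by
    rw [norm_smul, norm_eq_of_mem_sphere n, Real.norm_of_nonneg hr.le, mul_one]
  have := norm_sub_norm_le (y₁ - y₂) (r • (n : E3))
  rw [hn] at this
  rw [norm_sub_rev]
  have e : y₁ - (y₂ + r • (n : E3)) = y₁ - y₂ - r • (n : E3) := by abel
  rw [e]; linarith

lemma key (y₁ y₂ : E3) (s₁ s₂ : ℝ) (F : E3 → ℝ) (hFc : ContinuousOn F ({y₁, y₂}ᶜ : Set E3)) 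
    (ρ : ℝ) (hρ : 2 * ρ < ‖y₁ - y₂‖) (r' : ℝ) (hr' : 0 < r') (hrρ : r' < ρ) (L L1 : ℝ) (P : ℝ → ℝ)
    (hG : GPf y₁ y₂ s₁ s₂ (Gd y₁ F r') L) (hGi : ∀ s, 0 < s → IntegrableOn (Gd y₁ F r') (outS y₁ y₂ s))
    (hR : RPf s₁ r' (fun r => (r' + r ^ 2 / (3 * r') - r) * Sph y₁ F r) P L1) :
    ∃ ψ : ℝ → ℝ, HasExp (Sph y₂ (Fr y₁ F)) ψ ∧ 
      Tendsto (fun s => (∫ r in s..ρ, r ^ 2 * Sph y₂ (Fr y₁ F) r) + SUB s₂ s ψ) (𝓝[>] 0)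
        (𝓝 (3 / r' ^ 2 * (L - L1) - (∫ x in outS y₁ y₂ ρ, Fr y₁ F x) - ∫ r in r'..ρ, r * Sph y₁ F r)) := by
  obtain ⟨P1, P2, h1, h2, h3⟩ := hG
  obtain ⟨k1, k2, k3⟩ := hR
  have hfar : ∀ x ∈ outS y₁ y₂ r', Gd y₁ F r' x = r' ^ 2 / 3 * Fr y₁ F x := by
    intro x hx
    refine Gd_far y₁ F r' x hr' ?_
    simp only [outS, Set.mem_compl_iff, Set.mem_union, Metric.mem_closedBall, not_or, not_le, dist_eq_norm] at hx
    exact hx.1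
  have hE : HasExp (Sph y₂ (Fr y₁ F)) (fun a => 3 / r' ^ 2 * P2 a) := by
    refine (h2.const_mul (3 / r' ^ 2)).congr ⟨ρ, hr'.trans hrρ, fun r hr hrd => ?_⟩
    rw [Gd_y2 y₁ y₂ F r' r hr' hr (by linarith)]
    field_simp
  have hFri : IntegrableOn (Fr y₁ F) (outS y₁ y₂ r') := by
    have : IntegrableOn (fun x => 3 / r' ^ 2 * Gd y₁ F r' x) (outS y₁ y₂ r') := (hGi r' hr').const_mul _
    refine this.congr_fun (fun x hx => ?_) (outS_meas _ _ _)
    simp only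
    rw [hfar x hx]
    field_simp
  have hFrc : ContinuousOn (Fr y₁ F) ({y₁, y₂}ᶜ : Set E3) := by
    refine ContinuousOn.div hFc (by fun_prop) fun x hx => ?_
    rw [norm_ne_zero_iff, sub_ne_zero]
    rintro rfl
    exact hx (by simp)
  have hSphc : ∀ s t, 0 < s → s ≤ t → t ≤ ρ → IntervalIntegrable (fun r => r ^ 2 * Sph y₂ (Fr y₁ F) r) volume s t := by
    intro s t hs hst htρ
    refine ContinuousOn.intervalIntegrable ?_
    rw [Set.uIcc_of_le hst]
    refine ContinuousOn.mul (by fun_prop) (Sph_continuousOn hFrc y₂ _ inferInstance fun r hr n => sph_mem2 _ _ _ ?_ ?_ n)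
    · exact hs.trans_le hr.1
    · have := hr.2; have := hr.1; linarith
  refine ⟨_, hE, ?_⟩
  have h4 := ((h3.sub k3).const_mul (3 / r' ^ 2)).sub_const ((∫ x in outS y₁ y₂ ρ, Fr y₁ F x) + ∫ r in r'..ρ, r * Sph y₁ F r)
  rw [← sub_sub]  at h4
  refine h4.congr' ?_
  filter_upwards [eventually_Ioc r' hr'] with s hs
  obtain ⟨hs, hsr⟩ := hs
  have e1 : SUB s₁ s P1 = SUB s₁ s P := by
    refine SUB_congr _ _ (h1.unique (k1.congr ⟨r', hr', fun r hr hrd => ?_⟩))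
    exact Gd_near y₁ F r' r hr hrd.le
  have e2 : SUB s₂ s (fun a => 3 / r' ^ 2 * P2 a) = 3 / r' ^ 2 * SUB s₂ s P2 := SUB_const_mul h2 _
  have e3 := out_split y₁ y₂ _ s r' hs hsr (by linarith) (hGi s hs)
  have e4 := out_split y₁ y₂ _ r' ρ hr' hrρ.le hρ hFri
  have e5 : ∫ x in outS y₁ y₂ r', Gd y₁ F r' x = r' ^ 2 / 3 * ∫ x in outS y₁ y₂ r', Fr y₁ F x := by
    rw [← integral_const_mul]
    exact setIntegral_congr_fun (outS_meas _ _ _) hfar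
  have e6 : ∫ r in s..r', r ^ 2 * Sph y₁ (Gd y₁ F r') r = ∫ r in s..r', r ^ 2 * ((r' + r ^ 2 / (3 * r') - r) * Sph y₁ F r) := by
    refine intervalIntegral.integral_congr fun r hr => ?_
    rw [Set.uIcc_of_le hsr] at hr
    rw [Gd_near y₁ F r' r (hs.trans_le hr.1) hr.2]
  have e7 : ∫ r in s..r', r ^ 2 * Sph y₂ (Gd y₁ F r') r = r' ^ 2 / 3 * ∫ r in s..r', r ^ 2 * Sph y₂ (Fr y₁ F) r := by
    rw [← intervalIntegral.integral_const_mul]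
    refine intervalIntegral.integral_congr fun r hr => ?_
    rw [Set.uIcc_of_le hsr] at hr
    rw [Gd_y2 y₁ y₂ F r' r hr' (hs.trans_le hr.1) (by linarith [hr.2])]
    ring
  have e8 : ∫ r in r'..ρ, r ^ 2 * Sph y₁ (Fr y₁ F) r = ∫ r in r'..ρ, r * Sph y₁ F r := by
    refine intervalIntegral.integral_congr fun r hr => ?_
    rw [Set.uIcc_of_le hrρ.le] at hr
    exact Fr_near y₁ F r (hr'.trans_le hr.1)
  have e9 := intervalIntegral.integral_add_adjacent_intervals (hSphc s r' hs hsr hrρ.le) (hSphc r' ρ hr' hrρ.le le_rfl)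
  rw [e3, e5, e4, e6, e7, e8, e1, e2, ← e9]
  field_simp
  ring

lemma main_id (y₁ y₂ : E3) (s₁ s₂ : ℝ) (F : E3 → ℝ) (hFc : ContinuousOn F ({y₁, y₂}ᶜ : Set E3)) 
    (ρ : ℝ) (hρ0 : 0 < ρ) (hρ : 2 * ρ < ‖y₁ - y₂‖) (L L1 : ℝ → ℝ)
    (hG : ∀ r', 0 < r' → r' < ρ → GPf y₁ y₂ s₁ s₂ (Gd y₁ F r') (L r') ∧ ∀ s, 0 < s → IntegrableOn (Gd y₁ F r') (outS y₁ y₂ s))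
    (hR : ∀ r', 0 < r' → r' < ρ → ∃ P, RPf s₁ r' (fun r => (r' + r ^ 2 / (3 * r') - r) * Sph y₁ F r) P (L1 r')) :
    ∃ z : ℝ, ∀ r', 0 < r' → r' < ρ → L r' = L1 r' + r' ^ 2 / 3 * (z + ∫ r in r'..ρ, r * Sph y₁ F r) := by
  have K : ∀ r', 0 < r' → r' < ρ → ∃ ψ : ℝ → ℝ, HasExp (Sph y₂ (Fr y₁ F)) ψ ∧ 
      Tendsto (fun s => (∫ r in s..ρ, r ^ 2 * Sph y₂ (Fr y₁ F) r) + SUB s₂ s ψ) (𝓝[>] 0)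
        (𝓝 (3 / r' ^ 2 * (L r' - L1 r') - (∫ x in outS y₁ y₂ ρ, Fr y₁ F x) - ∫ r in r'..ρ, r * Sph y₁ F r)) := by
    intro r' h h'
    obtain ⟨P, hP⟩ := hR r' h h'
    exact key y₁ y₂ s₁ s₂ F hFc ρ hρ r' h h' _ _ P (hG r' h h').1 (hG r' h h').2 hP
  obtain ⟨ψ0, hψ0, T0⟩ := K (ρ / 2) (by linarith) (by linarith)
  generalize (3 / (ρ / 2) ^ 2 * (L (ρ / 2) - L1 (ρ / 2)) - (∫ x in outS y₁ y₂ ρ, Fr y₁ F x) - ∫ r in (ρ/2)..ρ, r * Sph y₁ F r) = z0 at T0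
  refine ⟨z0 + (∫ x in outS y₁ y₂ ρ, Fr y₁ F x), fun r' h h' => ?_⟩
  obtain ⟨ψ, hψ, T⟩ := K r' h h'
  have T' := T.congr fun s => by rw [SUB_congr s₂ s (hψ.unique hψ0)]
  have := tendsto_nhds_unique T' T0
  rw [← this]
  field_simp
  ring

lemma RPf.congr {σ ρ : ℝ} (hρ : 0 < ρ) {h h' P : ℝ → ℝ} {L : ℝ} (H : RPf σ ρ h P L)
    (he : ∀ r, 0 < r → r ≤ ρ → h' r = h r) : RPf σ ρ h' P L := by
  obtain ⟨h1, h2, h3⟩ := H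
  refine ⟨h1.congr ⟨ρ, hρ, fun r hr hrd => he r hr hrd.le⟩, fun s hs hs' => ?_, h3.congr' ?_⟩
  · refine (h2 s hs hs').congr fun r hr => ?_
    rw [Set.uIoc_of_le hs'] at hr
    rw [he r (hs.trans hr.1) hr.2]
  · filter_upwards [eventually_Ioc ρ hρ] with s hs
    congr 1
    refine intervalIntegral.integral_congr fun r hr => ?_
    rw [Set.uIcc_of_le hs.2] at hr
    rw [he r (hs.1.trans_le hr.1) hr.2]

lemma RPf_Phi (σ : ℝ) (hσ : 0 < σ) (Φ : ℝ → ℝ) (A : Finset ℝ) (φ : ℝ → ℝ) (ρ K : ℝ)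
    (hE : ∀ r, 0 < r → r ≤ ρ → |Φ r - ∑ a ∈ A, r ^ a * φ a| ≤ K) (hc : ContinuousOn Φ (Set.Ioc 0 ρ))
    (r' : ℝ) (hr' : 0 < r') (hrρ : r' < ρ) :
    ∃ e, |e| ≤ 2 * K * r' ^ 4 ∧ ∃ P, RPf σ r' (fun r => (r' + r ^ 2 / (3 * r') - r) * Φ r) P
      ((∑ a ∈ A, φ a * (r' * mm σ r' a + mm σ r' (a + 2) / (3 * r') - mm σ r' (a + 1))) + e) := by
  have hS : ContinuousOn (fun r : ℝ => ∑ a ∈ A, r ^ a * φ a) (Set.Ioc 0 r') := by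
    refine continuousOn_finsetSum _ fun a _ => ContinuousOn.mul (fun r hr => ?_) continuousOn_const
    exact (Real.continuousAt_rpow_const r a (Or.inl hr.1.ne')).continuousWithinAt
  obtain ⟨e, he, heb⟩ := RPf.bounded (σ := σ) hr' (fun r => (r' + r ^ 2 / (3 * r') - r) * (Φ r - ∑ a ∈ A, r ^ a * φ a)) (2 * r' * K) (by
      intro r hr hrr
      rw [abs_mul]
      have h1 := hE r hr (hrr.trans hrρ.le)
      have h2 : |r' + r ^ 2 / (3 * r') - r| ≤ 2 * r' := by
        have h3 : r ^ 2 / (3 * r') ≤ r' := by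
          rw [div_le_iff₀ (by positivity)]
          nlinarith
        have h4 : 0 ≤ r ^ 2 / (3 * r') := by positivity
        rw [abs_of_nonneg (by linarith)]
        linarith
      exact mul_le_mul h2 h1 (abs_nonneg _) (by positivity)) (by
      refine ContinuousOn.mul (by fun_prop) ((hc.mono (Set.Ioc_subset_Ioc_right hrρ.le)).sub hS))
  refine ⟨e, heb.trans (le_of_eq (by ring)), ?_⟩
  have hsum := RPf.sum (σ := σ) hr' A _ _ _ (fun a _ =>
    (((RPf.monomial σ r' a hσ hr').const_mul (φ a * r')).add hr'
      ((RPf.monomial σ r' (a + 2) hσ hr').const_mul (φ a / (3 * r')))).add hr'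
      ((RPf.monomial σ r' (a + 1) hσ hr').const_mul (-φ a)))
  have hfin := (hsum.add hr' he).congr hr' (h' := fun r => (r' + r ^ 2 / (3 * r') - r) * Φ r) (by
    intro r hr _
    rw [mul_sub, Finset.mul_sum]
    rw [eq_comm, ← eq_sub_iff_add_eq, sub_sub_cancel]
    refine Finset.sum_congr rfl fun a _ => ?_
    rw [Real.rpow_add hr, Real.rpow_add hr, Real.rpow_one, Real.rpow_two]
    field_simp
    ring)
  have eL : (∑ a ∈ A, φ a * (r' * mm σ r' a + mm σ r' (a + 2) / (3 * r') - mm σ r' (a + 1))) =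
      ∑ a ∈ A, (φ a * r' * mm σ r' a + φ a / (3 * r') * mm σ r' (a + 2) + -φ a * mm σ r' (a + 1)) := by
    refine Finset.sum_congr rfl fun a _ => ?_
    field_simp
    ring
  rw [eL]
  exact ⟨_, hfin⟩

lemma outer_Phi (σ : ℝ) (hσ : 0 < σ) (Φ : ℝ → ℝ) (A : Finset ℝ) (φ : ℝ → ℝ) (ρ K : ℝ)
    (hE : ∀ r, 0 < r → r ≤ ρ → |Φ r - ∑ a ∈ A, r ^ a * φ a| ≤ K) (hc : ContinuousOn Φ (Set.Ioc 0 ρ))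
    (r' : ℝ) (hr' : 0 < r') (hrρ : r' < ρ) :
    |(∫ r in r'..ρ, r * Φ r) - ∑ a ∈ A, φ a * (mm σ ρ (a - 1) - mm σ r' (a - 1))| ≤ K * ρ ^ 2 := by
  have hρ := hr'.trans hrρ
  have hK : 0 ≤ K := (abs_nonneg _).trans (hE ρ hρ le_rfl)
  have e1 : ∑ a ∈ A, φ a * (mm σ ρ (a - 1) - mm σ r' (a - 1)) = ∫ r in r'..ρ, ∑ a ∈ A, φ a * (r ^ 2 * r ^ (a - 1)) := by
    rw [intervalIntegral.integral_finsetSum fun a _ => (intervalIntegrable_rpow_pos (a - 1) r' ρ hr' hρ).const_mul _]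
    refine Finset.sum_congr rfl fun a _ => ?_
    rw [intervalIntegral.integral_const_mul, integral_mono_mm σ (a - 1) r' ρ hσ hr' hrρ.le]
  have i1 : IntervalIntegrable (fun r => r * Φ r) volume r' ρ := by
    refine ContinuousOn.intervalIntegrable (ContinuousOn.mul (by fun_prop) (hc.mono ?_))
    rw [Set.uIcc_of_le hrρ.le]
    intro r hr
    exact ⟨hr'.trans_le hr.1, hr.2⟩
  have i2 : IntervalIntegrable (fun r => ∑ a ∈ A, φ a * (r ^ 2 * r ^ (a - 1))) volume r' ρ := by
    refine ContinuousOn.intervalIntegrable (continuousOn_finsetSum _ fun a _ => ?_)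
    refine ContinuousOn.mul continuousOn_const (ContinuousOn.mul (by fun_prop) fun r hr => ?_)
    rw [Set.uIcc_of_le hrρ.le] at hr
    exact (Real.continuousAt_rpow_const r _ (Or.inl (hr'.trans_le hr.1).ne')).continuousWithinAt
  rw [e1, ← intervalIntegral.integral_sub i1 i2]
  have := intervalIntegral.norm_integral_le_of_norm_le_const (a := r') (b := ρ) (C := ρ * K)
    (f := fun r => r * Φ r - ∑ a ∈ A, φ a * (r ^ 2 * r ^ (a - 1))) (by
      intro r hr
      rw [Set.uIoc_of_le hrρ.le] at hr
      have hr0 : 0 < r := hr'.trans hr.1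
      have e : r * Φ r - ∑ a ∈ A, φ a * (r ^ 2 * r ^ (a - 1)) = r * (Φ r - ∑ a ∈ A, r ^ a * φ a) := by
        rw [mul_sub, Finset.mul_sum]
        congr 1
        refine Finset.sum_congr rfl fun a _ => ?_
        rw [Real.rpow_sub hr0, Real.rpow_one]
        field_simp
      rw [e, norm_mul, Real.norm_eq_abs, Real.norm_eq_abs, abs_of_pos hr0]
      exact mul_le_mul hr.2 (hE r hr0 hr.2) (abs_nonneg _) hρ.le)
  rw [Real.norm_eq_abs] at this
  refine this.trans ?_
  rw [abs_of_pos (by linarith)]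
  have : 0 ≤ ρ * K * r' := by positivity
  nlinarith

def wfun (σ a r' : ℝ) : ℝ :=
  r' * mm σ r' a + mm σ r' (a + 2) / (3 * r') - mm σ r' (a + 1) - r' ^ 2 / 3 * mm σ r' (a - 1)

lemma radial_final (σ : ℝ) (hσ : 0 < σ) (Φ : ℝ → ℝ) (A : Finset ℝ) (φ : ℝ → ℝ) (ρ K : ℝ) (hρ : 0 < ρ)
    (hE : ∀ r, 0 < r → r ≤ ρ → |Φ r - ∑ a ∈ A, r ^ a * φ a| ≤ K) (hc : ContinuousOn Φ (Set.Ioc 0 ρ))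
    (L e : ℝ → ℝ) (z : ℝ) (he : ∀ r', 0 < r' → r' < ρ → |e r'| ≤ 2 * K * r' ^ 4)
    (hL : ∀ r', 0 < r' → r' < ρ → L r' =
      ((∑ a ∈ A, φ a * (r' * mm σ r' a + mm σ r' (a + 2) / (3 * r') - mm σ r' (a + 1))) + e r') +
      r' ^ 2 / 3 * (z + ∫ r in r'..ρ, r * Φ r)) :
    Tendsto (fun r' => L r' - ∑ a ∈ A, φ a * wfun σ a r') (𝓝[>] 0) (𝓝 0) := by
  set M := ∑ a ∈ A, φ a * mm σ ρ (a - 1)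
  have hb : ∀ r', 0 < r' → r' < ρ → |L r' - ∑ a ∈ A, φ a * wfun σ a r'| ≤ 2 * K * r' ^ 4 + r' ^ 2 / 3 * (|z + M| + K * ρ ^ 2) := by
    intro r' hr' hrρ
    have h1 := outer_Phi σ hσ Φ A φ ρ K hE hc r' hr' hrρ
    have h2 := he r' hr' hrρ
    have e1 : L r' - ∑ a ∈ A, φ a * wfun σ a r' = e r' + r' ^ 2 / 3 * ((z + M) +
        ((∫ r in r'..ρ, r * Φ r) - ∑ a ∈ A, φ a * (mm σ ρ (a - 1) - mm σ r' (a - 1)))) := by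
      rw [hL r' hr' hrρ]
      simp only [wfun, M, mul_sub, mul_add, Finset.sum_sub_distrib, Finset.sum_add_distrib]
      have : ∑ a ∈ A, φ a * (r' ^ 2 / 3 * mm σ r' (a - 1)) = r' ^ 2 / 3 * ∑ a ∈ A, φ a * mm σ r' (a - 1) := by
        rw [Finset.mul_sum]
        exact Finset.sum_congr rfl fun a _ => by ring
      rw [this]
      ring
    rw [e1]
    refine (abs_add_le _ _).trans (add_le_add h2 ?_)
    rw [abs_mul, abs_of_pos (by positivity : 0 < r' ^ 2 / 3)]
    refine mul_le_mul_of_nonneg_left ((abs_add_le _ _).trans (add_le_add le_rfl h1)) (by positivity)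
  refine squeeze_zero_norm' (a := fun r' => 2 * K * r' ^ 4 + r' ^ 2 / 3 * (|z + M| + K * ρ ^ 2)) ?_ ?_
  · filter_upwards [eventually_Ioc (ρ / 2) (by linarith)] with r' hr'
    exact hb r' hr'.1 (by linarith [hr'.2])
  · have : Continuous (fun r' : ℝ => 2 * K * r' ^ 4 + r' ^ 2 / 3 * (|z + M| + K * ρ ^ 2)) := by fun_prop
    have := (this.tendsto 0).mono_left (nhdsWithin_le_nhds (s := Set.Ioi 0))
    simpa using this

def npSum (m : ℕ) (ca da : ℕ → ℝ) (r : ℝ) : ℝ :=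
  ∑ k ∈ Finset.range m, (ca k + da k * Real.log r) * r ^ (-(k : ℤ) - 1)

def NP (f : ℝ → ℝ) : Prop := ∃ (m : ℕ) (ca da : ℕ → ℝ),
  Tendsto (fun r => f r - npSum m ca da r) (𝓝[>] (0 : ℝ)) (𝓝 0)

lemma npSum_pad (m M : ℕ) (h : m ≤ M) (ca da : ℕ → ℝ) (r : ℝ) :
    npSum M (fun k => if k < m then ca k else 0) (fun k => if k < m then da k else 0) r = npSum m ca da r := by
  unfold npSum
  symm
  refine Finset.sum_subset_zero_on_sdiff (Finset.range_subset_range.2 h) ?_ ?_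
  · intro k hk
    simp only [Finset.mem_sdiff, Finset.mem_range] at hk
    simp [hk.2]
  · intro k hk
    simp only [Finset.mem_range] at hk
    simp [hk]

lemma NP.add {f g : ℝ → ℝ} (hf : NP f) (hg : NP g) : NP (fun r => f r + g r) := by
  obtain ⟨m, ca, da, h⟩ := hf
  obtain ⟨m', ca', da', h'⟩ := hg
  refine ⟨max m m', fun k => (if k < m then ca k else 0) + (if k < m' then ca' k else 0),
    fun k => (if k < m then da k else 0) + (if k < m' then da' k else 0), ?_⟩
  have := h.add h'
  rw [add_zero] at this
  refine this.congr fun r => ?_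
  rw [← npSum_pad m (max m m') (le_max_left _ _), ← npSum_pad m' (max m m') (le_max_right _ _)]
  have : ∀ (M : ℕ) (a b a' b' : ℕ → ℝ), npSum M (fun k => a k + a' k) (fun k => b k + b' k) r
      = npSum M a b r + npSum M a' b' r := by
    intro M a b a' b'
    unfold npSum
    rw [← Finset.sum_add_distrib]
    exact Finset.sum_congr rfl fun k _ => by ring
  rw [this]
  ring

lemma NP.const_mul {f : ℝ → ℝ} (hf : NP f) (t : ℝ) : NP (fun r => t * f r) := by
  obtain ⟨m, ca, da, h⟩ := hf
  refine ⟨m, fun k => t * ca k, fun k => t * da k, ?_⟩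
  have := h.const_mul t
  rw [mul_zero] at this
  refine this.congr fun r => ?_
  rw [mul_sub]
  congr 1
  unfold npSum
  rw [Finset.mul_sum]
  exact Finset.sum_congr rfl fun k _ => by ring

lemma NP.of_tendsto {f : ℝ → ℝ} (h : Tendsto f (𝓝[>] (0 : ℝ)) (𝓝 0)) : NP f :=
  ⟨0, 0, 0, by simpa [npSum] using h⟩

lemma NP.congr {f g : ℝ → ℝ} (hf : NP f) (h : ∀ r, 0 < r → g r = f r) : NP g := by
  obtain ⟨m, ca, da, hh⟩ := hf
  refine ⟨m, ca, da, hh.congr' ?_⟩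
  filter_upwards [self_mem_nhdsWithin] with r hr
  rw [h r hr]

lemma NP.sum {ι : Type*} (A : Finset ι) (f : ι → ℝ → ℝ) (h : ∀ a ∈ A, NP (f a)) :
    NP (fun r => ∑ a ∈ A, f a r) := by
  classical
  induction A using Finset.induction_on with
  | empty => simpa using NP.of_tendsto (f := fun _ => (0 : ℝ)) tendsto_const_nhds
  | insert a A ha ih =>
    refine ((h a (Finset.mem_insert_self _ _)).add (ih fun b hb => h b (Finset.mem_insert_of_mem hb))).congr ?_
    intro r _
    rw [Finset.sum_insert ha]

lemma NP.pow (k : ℕ) (u v : ℝ) : NP (fun r => (u + v * Real.log r) * r ^ (-(k : ℤ) - 1)) := by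
  refine ⟨k + 1, fun j => if j = k then u else 0, fun j => if j = k then v else 0, ?_⟩
  refine tendsto_const_nhds.congr fun r => ?_
  unfold npSum
  rw [Finset.sum_eq_single k]
  · simp
  · intro j _ hj; simp [hj]
  · intro hk; simp at hk

lemma NP.rpow_pos (C e : ℝ) (he : 0 < e) : NP (fun r => C * r ^ e) := by
  refine NP.of_tendsto ?_
  have : Tendsto (fun r : ℝ => r ^ e) (𝓝[>] 0) (𝓝 0) := by
    have := (Real.continuousAt_rpow_const 0 e (Or.inr he.le)).tendsto
    rw [Real.zero_rpow he.ne'] at this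
    exact this.mono_left nhdsWithin_le_nhds
  simpa using this.const_mul C

lemma NP.log_pos (C e σ : ℝ) (he : 0 < e) (hσ : 0 < σ) : NP (fun r => C * (Real.log (r / σ) * r ^ e)) := by
  have h1 : NP (fun r => C * (Real.log r * r ^ e)) := by
    refine NP.of_tendsto ?_
    simpa using (tendsto_log_mul_rpow_nhdsGT_zero he).const_mul C
  refine (h1.add (NP.rpow_pos (-(C * Real.log σ)) e he)).congr fun r hr => ?_
  rw [Real.log_div hr.ne' hσ.ne']
  ring

/-- the constant part of the radial weight -/
def w0 (σ a r : ℝ) : ℝ := if a = -4 then -(1 / 2) - Real.log (r / σ) else 0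

lemma NP.wfun (σ : ℝ) (hσ : 0 < σ) (k : ℤ) : NP (fun r => wfun σ k r - w0 σ k r) := by
  have key : ∀ r : ℝ, 0 < r → ∀ b e : ℝ, r ^ (b : ℝ) = r ^ e * r ^ (b - e) := by
    intro r hr b e
    rw [← Real.rpow_add hr]; congr 1; ring
  by_cases h4 : k = -4
  · subst h4
    refine (NP.of_tendsto (f := fun _ => (0 : ℝ)) tendsto_const_nhds).congr fun r hr => ?_
    have e1 : r ^ (-1 : ℝ) = r⁻¹ := Real.rpow_neg_one r
    have e2 : r ^ (-2 : ℝ) = (r ^ 2)⁻¹ := by rw [Real.rpow_neg hr.le, Real.rpow_two]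
    norm_num [_root_.wfun, w0, mm, e1, e2]
    field_simp
    ring
  have hw0 : ∀ r, w0 σ k r = 0 := by
    intro r
    have : (k : ℝ) ≠ -4 := by exact_mod_cast h4
    simp [w0, this]
  simp only [hw0, sub_zero]
  by_cases h3 : k = -3
  · subst h3
    refine ((NP.log_pos 1 1 σ one_pos hσ).add (NP.rpow_pos (1 / 6 - 1 + 1 / 3) 1 one_pos)).congr fun r hr => ?_
    have e1 : r ^ (-1 : ℝ) = r⁻¹ := Real.rpow_neg_one r
    norm_num [_root_.wfun, mm, e1]
    field_simp
    ring
  by_cases h2 : k = -2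
  · subst h2
    refine ((NP.log_pos (-1 / 3) 2 σ two_pos hσ).add (NP.rpow_pos (1 + 1 / 9 - 1 / 2) 2 two_pos)).congr fun r hr => ?_
    norm_num [_root_.wfun, mm]
    field_simp
    ring
  by_cases h5 : k = -5
  · subst h5
    refine (NP.pow 0 (-1 / 2 + 1 + 1 / 9 - Real.log σ / 3) (1 / 3)).congr fun r hr => ?_
    have e1 : r ^ (-1 : ℝ) = r⁻¹ := Real.rpow_neg_one r
    have e2 : r ^ (-2 : ℝ) = (r ^ 2)⁻¹ := by rw [Real.rpow_neg hr.le, Real.rpow_two]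
    have e3 : r ^ (-3 : ℝ) = (r ^ 3)⁻¹ := by
      rw [Real.rpow_neg hr.le]; norm_cast
    norm_num [_root_.wfun, mm, e1, e2, e3, Real.log_div hr.ne' hσ.ne']
    field_simp
    ring
  set C : ℝ := 1 / (k + 3) + 1 / (3 * (k + 5)) - 1 / (k + 4) - 1 / (3 * (k + 2)) with hC
  have hk2 : (k : ℝ) + 2 ≠ 0 := by intro h; apply h2; have : (k : ℝ) = -2 := by linarith
                                   exact_mod_cast this
  have hk3 : (k : ℝ) + 3 ≠ 0 := by intro h; apply h3; have : (k : ℝ) = -3 := by linarith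
                                   exact_mod_cast this
  have hk4 : (k : ℝ) + 4 ≠ 0 := by intro h; apply h4; have : (k : ℝ) = -4 := by linarith
                                   exact_mod_cast this
  have hk5 : (k : ℝ) + 5 ≠ 0 := by intro h; apply h5; have : (k : ℝ) = -5 := by linarith
                                   exact_mod_cast this
  have hw : ∀ r, 0 < r → _root_.wfun σ k r = C * r ^ ((k : ℝ) + 4) := by
    intro r hr
    have m1 : mm σ r k = r ^ ((k : ℝ) + 4) / r / (k + 3) := by
      rw [mm, if_neg (fun h => hk3 (by linarith)), show (k : ℝ) + 3 = (k + 4) - 1 by ring, Real.rpow_sub_one hr.ne']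
    have m2 : mm σ r (k + 2) = r ^ ((k : ℝ) + 4) * r / (k + 5) := by
      rw [mm, if_neg (fun h => hk5 (by linarith)), show (k : ℝ) + 2 + 3 = (k + 4) + 1 by ring, Real.rpow_add_one hr.ne']
      ring
    have m3 : mm σ r (k + 1) = r ^ ((k : ℝ) + 4) / (k + 4) := by
      rw [mm, if_neg (fun h => hk4 (by linarith)), show (k : ℝ) + 1 + 3 = (k + 4) by ring]
    have m4 : mm σ r (k - 1) = r ^ ((k : ℝ) + 4) / r ^ 2 / (k + 2) := by
      rw [mm, if_neg (fun h => hk2 (by linarith)), show (k : ℝ) - 1 + 3 = (k + 4) - 2 by ring, Real.rpow_sub hr, Real.rpow_two]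
      ring
    rw [_root_.wfun, m1, m2, m3, m4, hC]
    field_simp
  by_cases hpos : -4 < k
  · have : (0 : ℝ) < k + 4 := by
      have : (-4 : ℝ) < k := by exact_mod_cast hpos
      linarith
    exact (NP.rpow_pos C _ this).congr hw
  · obtain ⟨j, hj⟩ : ∃ j : ℕ, k + 4 = -(j : ℤ) - 1 := ⟨(-(k + 5)).toNat, by omega⟩
    refine (NP.pow j C 0).congr fun r hr => ?_
    rw [hw r hr, ← hj, zero_mul, add_zero, ← Real.rpow_intCast]
    push_cast
    rfl

/-- partie finie of the twice-iterated Poisson integral at a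
singular point.  The angular average of `Q(y₁ + r'n')` admits, as `r' → 0⁺`, an
expansion whose `r'⁰`-part (including its `ln r'` term) is
`Q(y₁) + [ln(r'/s₁) + 1/2](r₁⁴F)₁`, preceded by finitely many negative powers of
`r'` with possible `ln r'` coefficients. -/
theorem pf_of_iterated_poisson_integral_at_singularity
    (y₁ y₂ : E3) (hy : y₁ ≠ y₂) (s₁ s₂ : ℝ) (hs₁ : 0 < s₁) (hs₂ : 0 < s₂)
    (F : E3 → ℝ) (c d : ℝ → S2 → ℝ) (hF : MemF y₁ y₂ F c d)
    (hci : IntegerExponents c) (hdi : IntegerExponents d)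
    (η : ℝ) (hη : 0 < η)
    (hdecay : ∃ C R : ℝ, ∀ x : E3, R ≤ ‖x‖ → |F x| ≤ C * ‖x‖ ^ (-5 - η))
    -- the iterated Poisson integral Q(x') = −(1/4π) Pf ∫ |x−x'| F(x) d³x, x' ∉ {y₁,y₂}
    (Q : E3 → ℝ)
    (hQ : ∀ x' : E3, x' ≠ y₁ → x' ≠ y₂ →
      ∃ p q : ℝ → S2 → ℝ,
        HasSingExpansion y₁ (fun x => ‖x - x'‖ * F x) p
        ∧ HasSingExpansion y₂ (fun x => ‖x - x'‖ * F x) q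
        ∧ HasPfIntegral y₁ y₂ s₁ s₂ (fun x => ‖x - x'‖ * F x) p q (-(4 * π) * Q x'))
    -- the regularized value Q(y₁) = −(1/4π) Pf ∫ r₁ F(x) d³x
    (Qy₁ : ℝ)
    (hQy₁ : ∃ p q : ℝ → S2 → ℝ,
        HasSingExpansion y₁ (fun x => ‖x - y₁‖ * F x) p
        ∧ HasSingExpansion y₂ (fun x => ‖x - y₁‖ * F x) q
        ∧ HasPfIntegral y₁ y₂ s₁ s₂ (fun x => ‖x - y₁‖ * F x) p q (-(4 * π) * Qy₁)) :
    ∃ (m : ℕ) (ca da : ℕ → ℝ),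
      Tendsto
        (fun r' : ℝ =>
          (4 * π)⁻¹ * (∫ n : S2, Q (y₁ + r' • (n : E3)) ∂dOmega)
            - ((∑ k ∈ Finset.range m, (ca k + da k * Real.log r') * r' ^ (-(k : ℤ) - 1))
              + ((4 * π)⁻¹ * ∫ n : S2, c (-4) n ∂dOmega) * Real.log (r' / s₁)
              + (Qy₁ + (1 / 2) * ((4 * π)⁻¹ * ∫ n : S2, c (-4) n ∂dOmega))))
        (𝓝[>] (0 : ℝ)) (𝓝 0) := by
  have hd : 0 < ‖y₁ - y₂‖ := norm_pos_iff.2 (sub_ne_zero.2 hy)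
  have hFc : ContinuousOn F ({y₁, y₂}ᶜ : Set E3) := hF.smooth.continuousOn
  have hInteg : ∀ s, 0 < s → IntegrableOn (fun x => (1 + ‖x‖) * F x) (outS y₁ y₂ s) :=
    fun s hs => out_integrable y₁ y₂ F hFc η hη hdecay s hs
  obtain ⟨A, hA0, hAc, hAne, δ, hδ, hexp⟩ := hF.exp₁.trunc
  set φ : ℝ → ℝ := fun a => ∫ n : S2, c a n ∂dOmega with hφ
  set ρ : ℝ := min (δ / 2) (‖y₁ - y₂‖ / 4) with hρdef
  have hρ : 0 < ρ := by positivity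
  have hρδ : ρ < δ := (min_le_left _ _).trans_lt (by linarith)
  have hρd : 2 * ρ < ‖y₁ - y₂‖ := by
    have : ρ ≤ ‖y₁ - y₂‖ / 4 := min_le_right _ _
    linarith
  have hcΦ : ContinuousOn (Sph y₁ F) (Set.Ioc 0 ρ) := by
    have h1 : ContinuousOn (Sph y₁ F) (Set.Ioo 0 ‖y₁ - y₂‖) :=
      Sph_continuousOn hFc y₁ _ isOpen_Ioo.locallyCompactSpace
        (fun r hr n => sph_mem1 y₁ y₂ r hr.1 hr.2 n)
    exact h1.mono fun r hr => ⟨hr.1, by linarith [hr.2]⟩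
  have hE : ∀ r, 0 < r → r ≤ ρ → |Sph y₁ F r - ∑ a ∈ A, r ^ a * φ a| ≤ 1 * (4 * π) := by
    intro r hr hrρ
    have i1 : Integrable (fun n : S2 => F (y₁ + r • (n : E3))) dOmega :=
      sphere_integrable (cont_sph hFc y₁ r (sph_mem1 y₁ y₂ r hr (by linarith)))
    have i2 : ∀ a ∈ A, Integrable (fun n : S2 => r ^ a * c a n) dOmega := fun a _ =>
      sphere_integrable ((hF.exp₁.smooth_coeffs a).continuous.const_mul _)
    have e : Sph y₁ F r - ∑ a ∈ A, r ^ a * φ a =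
        ∫ n : S2, (F (y₁ + r • (n : E3)) - ∑ a ∈ A, r ^ a * c a n) ∂dOmega := by
      rw [integral_sub i1 (integrable_finsetSum _ i2), integral_finsetSum _ i2]
      simp only [integral_const_mul]
      rfl
    rw [e]
    exact sphere_int_le _ _ fun n => hexp r hr (hrρ.trans_lt hρδ) n
  have hQ1 : GPf y₁ y₂ s₁ s₂ (fun x => ‖x - y₁‖ * F x) (-(4 * π) * Qy₁) := by
    obtain ⟨p, q, hp, hq, h⟩ := hQy₁
    exact GPf.of_Pf hy (ContinuousOn.mul (by fun_prop) hFc) hp hq h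
  set L : ℝ → ℝ := fun r' => -(∫ n : S2, Q (y₁ + r' • (n : E3)) ∂dOmega) + 4 * π * Qy₁ with hL
  have hG : ∀ r', 0 < r' → r' < ρ → GPf y₁ y₂ s₁ s₂ (Gd y₁ F r') (L r') ∧
      ∀ s, 0 < s → IntegrableOn (Gd y₁ F r') (outS y₁ y₂ s) := by
    intro r' hr' hrρ
    have h1 := avg_GPf y₁ y₂ hy s₁ s₂ hs₁ hs₂ F c d hF hInteg Q hQ r' hr' (by linarith)
    rw [integral_const_mul] at h1
    exact diff_GPf y₁ y₂ hy s₁ s₂ F hFc hInteg r' hr' _ _ h1 hQ1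
  have hR := fun (r' : ℝ) (h : 0 < r') (h' : r' < ρ) =>
    RPf_Phi s₁ hs₁ (Sph y₁ F) A φ ρ _ hE hcΦ r' h h'
  choose! e heb hP using hR
  obtain ⟨z, hz⟩ := main_id y₁ y₂ s₁ s₂ F hFc ρ hρ hρd L _ hG hP
  have hT := radial_final s₁ hs₁ (Sph y₁ F) A φ ρ _ hρ hE hcΦ L e z heb hz
  have hNP : NP (fun r => ∑ a ∈ A, φ a * (wfun s₁ a r - w0 s₁ a r)) := by
    refine NP.sum A _ fun a ha => ?_
    obtain ⟨k, rfl⟩ := hci a (hAne a ha)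
    exact (NP.wfun s₁ hs₁ k).const_mul _
  have hsum0 : ∀ r, ∑ a ∈ A, φ a * w0 s₁ a r = φ (-4) * (-(1 / 2) - Real.log (r / s₁)) := by
    intro r
    by_cases h4 : (-4 : ℝ) ∈ A
    · rw [Finset.sum_eq_single_of_mem _ h4 (fun b _ hb => by simp [w0, hb])]
      simp [w0]
    · have : φ (-4) = 0 := by
        simp [hφ, hAc (-4) (by norm_num) h4]
      rw [this, zero_mul]
      refine Finset.sum_eq_zero fun b hb => ?_
      have : b ≠ -4 := fun h => h4 (h ▸ hb)
      simp [w0, this]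
  obtain ⟨m, ca, da, hfin⟩ := ((NP.of_tendsto hT).add hNP).const_mul (-(4 * π)⁻¹)
  refine ⟨m, ca, da, hfin.congr fun r => ?_⟩
  have hs := hsum0 r
  have hpi : (4 * π) ≠ 0 := by positivity
  simp only [mul_sub, Finset.sum_sub_distrib] at hs ⊢
  rw [hs]
  have hnp : (∑ k ∈ Finset.range m, (ca k + da k * Real.log r) * r ^ (-(k : ℤ) - 1)) = npSum m ca da r := rfl
  rw [hnp]
  generalize npSum m ca da r = N
  simp only [hL, hφ]
  field_simp
  ring

end
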